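/- arXiv:1510.08258 — 3 statements merged into one kernel-verified Lean document; each statement's English description precedes it below -/
import Mathlib

section
/- (Equality case of the UBT for ASP.) Let P ∈ P(d,n,s) and suppose f_{i−1}(P) = f_{i−1}(C(d,n,s)) for some i with ⌊(d−1)/2⌋ ≤ i ≤ d, where C(d,n,s) is the almost cyclic polytope. Then P is ⌊(d−1)/2⌋-neighborly, i.e. every subset of at most ⌊(d−1)/2⌋ vertices of P is the vertex set of a face of P. -/
open Finset

namespace ASP

noncomputable section

/-- The dot product of two vectors in `ℝ^d`. -/
def dotp {d : ℕ} (x y : Fin d → ℝ) : ℝ := ∑ i, x i * y i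

/-- `F` is a face of the polytope `P ⊆ ℝ^d`: the intersection of `P` with a supporting
hyperplane, together with the empty face and `P` itself. -/
def IsFaceOf {d : ℕ} (P F : Set (Fin d → ℝ)) : Prop :=
  F = ∅ ∨ F = P ∨
    ∃ (b : Fin d → ℝ) (c : ℝ), b ≠ 0 ∧ (∀ x ∈ P, dotp b x ≤ c) ∧
      F = {x ∈ P | dotp b x = c}

/-- The dimension of a subset of `ℝ^d`: the dimension of its affine span. -/
def polyDim {d : ℕ} (S : Set (Fin d → ℝ)) : ℕ :=
  Module.finrank ℝ (affineSpan ℝ S).direction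

/-- A polytope: the convex hull of a finite point set. -/
def IsPolytope {d : ℕ} (P : Set (Fin d → ℝ)) : Prop :=
  ∃ V : Finset (Fin d → ℝ), P = convexHull ℝ (V : Set (Fin d → ℝ))

/-- The vertex set of a polytope: its set of extreme points. -/
def verts {d : ℕ} (P : Set (Fin d → ℝ)) : Set (Fin d → ℝ) :=
  Set.extremePoints ℝ P

/-- `fVec P i` is the number of `i`-dimensional (nonempty) faces of `P`. -/
def fVec {d : ℕ} (P : Set (Fin d → ℝ)) (i : ℕ) : ℕ :=
  {F : Set (Fin d → ℝ) | IsFaceOf P F ∧ F.Nonempty ∧ polyDim F = i}.ncard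

/-- A facet of a `d`-polytope in `ℝ^d`: a `(d-1)`-dimensional face. -/
def IsFacetOf {d : ℕ} (P F : Set (Fin d → ℝ)) : Prop :=
  IsFaceOf P F ∧ F.Nonempty ∧ polyDim F = d - 1

/-- `(P, F)` is an ASP-pair: `P` is a `d`-polytope, `F` is a facet of `P`, and every facet
of `P` other than `F` is a simplex (i.e. has exactly `d` vertices). -/
def IsASPPair {d : ℕ} (P F : Set (Fin d → ℝ)) : Prop :=
  IsPolytope P ∧ polyDim P = d ∧ IsFacetOf P F ∧
    ∀ G, IsFacetOf P G → G ≠ F → (verts G).ncard = d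

/-- `P ∈ 𝒫(d,n,s)`: `P` is a `d`-polytope with `n` vertices such that `(P,F)` is an
ASP-pair where the facet `F` has `d + s` vertices. -/
def MemASP (d n s : ℕ) (P : Set (Fin d → ℝ)) : Prop :=
  (verts P).ncard = n ∧ ∃ F, IsASPPair P F ∧ (verts F).ncard = d + s

/-- `fBall P i` is `f_{i-1}(P')` of the simplicial ball `P' = ∂P - {F}` consisting of all
proper faces of `P` except its (unique non-simplex) facet `F`; the index is shifted by one,
so `fBall P 0 = f_{-1} = 1` counts the empty face, and at the top dimension the facet `F`
is discarded. -/
def fBall {d : ℕ} (P : Set (Fin d → ℝ)) (i : ℕ) : ℤ :=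
  if i = 0 then 1
  else if i = d then (fVec P (d - 1) : ℤ) - 1
  else if d < i then 0
  else (fVec P (i - 1) : ℤ)

/-- `hBall P k` is `h_k(P')` of the `(d-1)`-dimensional ball `P' = ∂P - {F}`, defined by
`h_k = ∑_{i=0}^{k} (-1)^{k-i} C(d-i, k-i) f_{i-1}(P')`, extended by `0` outside `0 ≤ k ≤ d`. -/
def hBall {d : ℕ} (P : Set (Fin d → ℝ)) (k : ℤ) : ℤ :=
  if 0 ≤ k ∧ k ≤ (d : ℤ) then
    ∑ i ∈ Finset.range (k.toNat + 1),
      (-1) ^ (k.toNat - i) * ((d - i).choose (k.toNat - i) : ℤ) * fBall P i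
  else 0

/-- `fBd m Q i` is `f_{i-1}(∂Q)` of the boundary complex of an `m`-polytope `Q ⊆ ℝ^d`
(a complex of dimension `m - 1`); the index is shifted by one. -/
def fBd {d : ℕ} (m : ℕ) (Q : Set (Fin d → ℝ)) (i : ℕ) : ℤ :=
  if i = 0 then 1 else if m + 1 ≤ i then 0 else (fVec Q (i - 1) : ℤ)

/-- `hBd m Q k` is `h_k(∂Q)` for the boundary complex of an `m`-polytope `Q ⊆ ℝ^d`, defined by
`h_k = ∑_{i=0}^{k} (-1)^{k-i} C(m-i, k-i) f_{i-1}(∂Q)`, extended by `0` outside `0 ≤ k ≤ m`. -/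
def hBd {d : ℕ} (m : ℕ) (Q : Set (Fin d → ℝ)) (k : ℤ) : ℤ :=
  if 0 ≤ k ∧ k ≤ (m : ℤ) then
    ∑ i ∈ Finset.range (k.toNat + 1),
      (-1) ^ (k.toNat - i) * ((m - i).choose (k.toNat - i) : ℤ) * fBd m Q i
  else 0

/-- `gBd m Q k = g_k(∂Q) = h_k(∂Q) - h_{k-1}(∂Q)`. -/
def gBd {d : ℕ} (m : ℕ) (Q : Set (Fin d → ℝ)) (k : ℤ) : ℤ :=
  hBd m Q k - hBd m Q (k - 1)

/-- The function `p(t) = (n-1)^{(t-1)(d-1)} · t(t+1)⋯(t+d+s-1)` (real exponentiation of the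
positive base `n-1`) used to define the almost cyclic polytope. -/
def acp (d n s : ℕ) (t : ℝ) : ℝ :=
  ((n : ℝ) - 1) ^ ((t - 1) * ((d : ℝ) - 1)) * ∏ l ∈ Finset.range (d + s), (t + l)

/-- The curve `y(t) = (t, t², …, t^{d-1}, p(t)) ∈ ℝ^d`. -/
def acy (d n s : ℕ) (t : ℝ) : Fin d → ℝ :=
  fun i => if (i : ℕ) + 1 = d then acp d n s t else t ^ ((i : ℕ) + 1)

/-- The parameter values `t_i = -s - d + i` for `i = 1, …, n` (here `0`-indexed:
`acT d s j = t_{j+1}`). -/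
def acT (d s j : ℕ) : ℝ := (j : ℝ) + 1 - s - d

/-- The `n` points `y(t_1), …, y(t_n)` on the curve `y` (`0`-indexed). -/
def acPoint (d n s : ℕ) (j : Fin n) : Fin d → ℝ := acy d n s (acT d s (j : ℕ))

/-- The almost cyclic polytope `C(d,n,s) = conv{y(t_1), …, y(t_n)}`. -/
def acPolytope (d n s : ℕ) : Set (Fin d → ℝ) :=
  convexHull ℝ (Set.range (acPoint d n s))

/-- The non-simplex facet `F = conv{y(t_1), …, y(t_{d+s})}` of the almost cyclic polytope. -/
def acFacet (d n s : ℕ) : Set (Fin d → ℝ) :=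
  convexHull ℝ (acPoint d n s '' {j : Fin n | (j : ℕ) < d + s})

/-- The generalized moment curve
`x(t) = (t, t², …, t^{d-r}, p_1(t), …, p_r(t)) ∈ ℝ^d`. -/
def gmc (d r : ℕ) (p : Fin r → ℝ → ℝ) (t : ℝ) : Fin d → ℝ :=
  fun i =>
    if h : (i : ℕ) < d - r then t ^ ((i : ℕ) + 1)
    else p ⟨(i : ℕ) - (d - r), by have h2 := i.2; omega⟩ t

/-- A polytope is `k`-neighborly if each subset of at most `k` of its vertices is the
vertex set of a face. -/
def IsNeighborly {d : ℕ} (k : ℕ) (P : Set (Fin d → ℝ)) : Prop :=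
  ∀ S : Finset (Fin d → ℝ), (S : Set (Fin d → ℝ)) ⊆ verts P → S.card ≤ k →
    ∃ G : Set (Fin d → ℝ), IsFaceOf P G ∧ verts G = (S : Set (Fin d → ℝ))

/-- The point `y` is beyond the facet `F` of the polytope `P`: for every supporting
hyperplane of `P` cutting out a facet, `y` is strictly on the outer side if the facet is `F`,
and strictly on the inner side otherwise. -/
def IsBeyond {d : ℕ} (P F : Set (Fin d → ℝ)) (y : Fin d → ℝ) : Prop :=
  ∀ (b : Fin d → ℝ) (c : ℝ), b ≠ 0 → (∀ x ∈ P, dotp b x ≤ c) →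
    IsFacetOf P {x ∈ P | dotp b x = c} →
      (({x ∈ P | dotp b x = c} = F → c < dotp b y) ∧
       ({x ∈ P | dotp b x = c} ≠ F → dotp b y < c))



section Comb
variable {α : Type*} [DecidableEq α]

def cc (d r j : ℕ) : ℕ := if r ≤ j then (d - r).choose (j - r) else 0

lemma card_interval {d j : ℕ} {R G : Finset α} (h : R ⊆ G) (hG : G.card = d) :
    ((G.powerset.filter (fun S => R ⊆ S ∧ S.card = j)).card) = cc d R.card j := by
  unfold cc
  split_ifs with hj
  · rw [← hG, ← card_sdiff_of_subset h, ← card_powersetCard]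
    refine card_bij' (fun S _ => S \ R) (fun S _ => S ∪ R) ?_ ?_ ?_ ?_
    · intro S hS
      simp only [mem_filter, mem_powerset] at hS
      rw [mem_powersetCard]
      exact ⟨sdiff_subset_sdiff hS.1 le_rfl, by rw [card_sdiff_of_subset hS.2.1, hS.2.2]⟩
    · intro S hS
      rw [mem_powersetCard] at hS
      simp only [mem_filter, mem_powerset]
      refine ⟨union_subset (hS.1.trans sdiff_subset) h, subset_union_right, ?_⟩
      rw [card_union_of_disjoint (disjoint_of_subset_left hS.1 sdiff_disjoint), hS.2]
      omega
    · intro S hS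
      simp only [mem_filter, mem_powerset] at hS
      exact sdiff_union_of_subset hS.2.1
    · intro S hS
      rw [mem_powersetCard] at hS
      exact union_sdiff_cancel_right (disjoint_of_subset_left hS.1 sdiff_disjoint)
  · rw [card_eq_zero, filter_eq_empty_iff]
    intro S _ h2
    have := card_le_card h2.1
    omega

lemma count_faces {d j : ℕ} {𝓕 𝓐 : Finset (Finset α)} {r : Finset α → Finset α}
    (hr : ∀ G ∈ 𝓕, r G ⊆ G) (hd : ∀ G ∈ 𝓕, G.card = d) (hA : ∀ S ∈ 𝓐, S.card = j)
    (h1 : ∀ S ∈ 𝓐, ∃! G, G ∈ 𝓕 ∧ S ⊆ G ∧ r G ⊆ S)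
    (h2 : ∀ G ∈ 𝓕, ∀ S, r G ⊆ S → S ⊆ G → S.card = j → S ∈ 𝓐) :
    𝓐.card = ∑ G ∈ 𝓕, cc d (r G).card j := by
  have : 𝓐 = 𝓕.biUnion (fun G => G.powerset.filter (fun S => r G ⊆ S ∧ S.card = j)) := by
    ext S
    simp only [mem_biUnion, mem_filter, mem_powerset]
    constructor
    · intro h
      obtain ⟨G, ⟨a, b, c⟩, -⟩ := h1 S h
      exact ⟨G, a, b, c, hA S h⟩
    · rintro ⟨G, a, b, c, e⟩
      exact h2 G a S c b e
  have h3 : (𝓕 : Set (Finset α)).PairwiseDisjoint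
      (fun G => G.powerset.filter (fun S => r G ⊆ S ∧ S.card = j)) := by
    intro G hG G' hG' hne
    rw [Function.onFun, disjoint_left]
    intro S hS hS'
    simp only [mem_filter, mem_powerset] at hS hS'
    have hSA := h2 G hG S hS.2.1 hS.1 hS.2.2
    exact hne ((h1 S hSA).unique ⟨hG, hS.1, hS.2.1⟩ ⟨hG', hS'.1, hS'.2.1⟩)
  rw [this, card_biUnion h3]
  exact sum_congr rfl fun G hG => card_interval (hr G hG) (hd G hG)

def cnt (𝓕 : Finset (Finset α)) (r : Finset α → Finset α) (k : ℕ) : ℕ :=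
  (𝓕.filter (fun G => (r G).card = k)).card

lemma sum_cc_eq (d j : ℕ) (𝓕 : Finset (Finset α)) (r : Finset α → Finset α) :
    ∑ G ∈ 𝓕, cc d (r G).card j = ∑ k ∈ range (j+1), (d - k).choose (j - k) * cnt 𝓕 r k := by
  have : ∀ G ∈ 𝓕, cc d (r G).card j =
      ∑ k ∈ range (j+1), if (r G).card = k then (d-k).choose (j-k) else 0 := by
    intro G _
    rw [sum_ite_eq]
    unfold cc
    simp only [mem_range, Nat.lt_succ_iff]
  rw [sum_congr rfl this, sum_comm]
  refine sum_congr rfl fun k _ => ?_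
  rw [← sum_filter, sum_const, smul_eq_mul, mul_comm, cnt]

lemma cnt_unique {d : ℕ} {x y : ℕ → ℕ}
    (K : ℕ) (h : ∀ j ≤ K, ∑ k ∈ range (j+1), (d - k).choose (j - k) * x k =
      ∑ k ∈ range (j+1), (d - k).choose (j - k) * y k) : ∀ k ≤ K, x k = y k := by
  intro k
  induction k using Nat.strong_induction_on with
  | _ k ih =>
    intro hk
    have h1 := h k hk
    rw [sum_range_succ, sum_range_succ, sum_congr rfl (g := fun i => (d - i).choose (k - i) * y i)
      (fun i hi => by rw [ih i (mem_range.1 hi) (by have := mem_range.1 hi; omega)])] at h1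
    simpa using h1

structure Sweep (𝓕 : Finset (Finset α)) (F : Finset α) (R : Finset α → Finset α) : Prop where
  sub : ∀ G ∈ 𝓕, R G ⊆ G
  low : ∀ S, ∀ G0 ∈ 𝓕, S ⊆ G0 → ∃! G, G ∈ 𝓕 ∧ S ⊆ G ∧ R G ⊆ S
  up : ∀ S, ∀ G0 ∈ 𝓕, S ⊆ G0 → ¬ S ⊆ F → ∃! G, G ∈ 𝓕 ∧ S ⊆ G ∧ G \ R G ⊆ S
  upF : ∀ S, S ⊆ F → ∀ G ∈ 𝓕, S ⊆ G → ¬ (G \ R G ⊆ S)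

def faces (𝓕 : Finset (Finset α)) (j : ℕ) : Finset (Finset α) :=
  (𝓕.biUnion powerset).filter (fun S => S.card = j)

lemma mem_faces {𝓕 : Finset (Finset α)} {j : ℕ} {S : Finset α} :
    S ∈ faces 𝓕 j ↔ (∃ G ∈ 𝓕, S ⊆ G) ∧ S.card = j := by
  simp [faces]

variable {d s : ℕ} {V F : Finset α} {𝓕 : Finset (Finset α)} {R R' : Finset α → Finset α}

lemma Sweep.f_eq (h : Sweep 𝓕 F R) (hd : ∀ G ∈ 𝓕, G.card = d) (j : ℕ) :
    (faces 𝓕 j).card = ∑ k ∈ range (j+1), (d - k).choose (j - k) * cnt 𝓕 R k := by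
  rw [← sum_cc_eq]
  refine count_faces h.sub hd (fun S hS => (mem_faces.1 hS).2) (fun S hS => ?_) ?_
  · obtain ⟨⟨G, hG, hSG⟩, -⟩ := mem_faces.1 hS
    exact h.low S G hG hSG
  · intro G hG S _ h2 h3
    exact mem_faces.2 ⟨⟨G, hG, h2⟩, h3⟩

lemma Sweep.fint_eq (h : Sweep 𝓕 F R) (hd : ∀ G ∈ 𝓕, G.card = d) (j : ℕ) :
    ((faces 𝓕 j).filter (fun S => ¬ S ⊆ F)).card =
      ∑ k ∈ range (j+1), (d - k).choose (j - k) * cnt 𝓕 (fun G => G \ R G) k := by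
  rw [← sum_cc_eq]
  refine count_faces (fun G hG => sdiff_subset) hd
    (fun S hS => (mem_faces.1 (mem_filter.1 hS).1).2) (fun S hS => ?_) ?_
  · obtain ⟨hS, hSF⟩ := mem_filter.1 hS
    obtain ⟨⟨G, hG, hSG⟩, -⟩ := mem_faces.1 hS
    exact h.up S G hG hSG hSF
  · intro G hG S h1 h2 h3
    exact mem_filter.2 ⟨mem_faces.2 ⟨⟨G, hG, h2⟩, h3⟩, fun hSF => h.upF S hSF G hG h2 h1⟩

lemma Sweep.fl_eq (h : Sweep 𝓕 F R) (hd : ∀ G ∈ 𝓕, G.card = d) (v : α) (j : ℕ) :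
    ((faces 𝓕 j).filter (fun S => v ∈ S)).card =
      ∑ k ∈ range (j+1), (d - k).choose (j - k) *
        cnt (𝓕.filter (fun G => v ∈ G)) (fun G => insert v (R G)) k := by
  rw [← sum_cc_eq]
  refine count_faces (fun G hG => ?_) (fun G hG => hd G (mem_filter.1 hG).1)
    (fun S hS => (mem_faces.1 (mem_filter.1 hS).1).2) (fun S hS => ?_) ?_
  · exact insert_subset (mem_filter.1 hG).2 (h.sub G (mem_filter.1 hG).1)
  · obtain ⟨hS, hSF⟩ := mem_filter.1 hS
    obtain ⟨⟨G, hG, hSG⟩, -⟩ := mem_faces.1 hS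
    obtain ⟨G', ⟨a, b, c⟩, e⟩ := h.low S G hG hSG
    refine ⟨G', ⟨mem_filter.2 ⟨a, b hSF⟩, b, insert_subset hSF c⟩, ?_⟩
    rintro G'' ⟨a', b', c'⟩
    exact e G'' ⟨(mem_filter.1 a').1, b', (subset_insert _ _).trans c'⟩
  · intro G hG S h1 h2 h3
    exact mem_filter.2 ⟨mem_faces.2 ⟨⟨G, (mem_filter.1 hG).1, h2⟩, h3⟩, h1 (mem_insert_self _ _)⟩

lemma Sweep.flint_eq (h : Sweep 𝓕 F R) (hd : ∀ G ∈ 𝓕, G.card = d) (v : α) (j : ℕ) :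
    ((faces 𝓕 j).filter (fun S => v ∈ S ∧ ¬ S ⊆ F)).card =
      ∑ k ∈ range (j+1), (d - k).choose (j - k) *
        cnt (𝓕.filter (fun G => v ∈ G)) (fun G => insert v (G \ R G)) k := by
  rw [← sum_cc_eq]
  refine count_faces (fun G hG => ?_) (fun G hG => hd G (mem_filter.1 hG).1)
    (fun S hS => (mem_faces.1 (mem_filter.1 hS).1).2) (fun S hS => ?_) ?_
  · exact insert_subset (mem_filter.1 hG).2 sdiff_subset
  · obtain ⟨hS, hvS, hSF⟩ := mem_filter.1 hS
    obtain ⟨⟨G, hG, hSG⟩, -⟩ := mem_faces.1 hS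
    obtain ⟨G', ⟨a, b, c⟩, e⟩ := h.up S G hG hSG hSF
    refine ⟨G', ⟨mem_filter.2 ⟨a, b hvS⟩, b, insert_subset hvS c⟩, ?_⟩
    rintro G'' ⟨a', b', c'⟩
    exact e G'' ⟨(mem_filter.1 a').1, b', (subset_insert _ _).trans c'⟩
  · intro G hG S h1 h2 h3
    exact mem_filter.2 ⟨mem_faces.2 ⟨⟨G, (mem_filter.1 hG).1, h2⟩, h3⟩, h1 (mem_insert_self _ _),
      fun hSF => h.upF S hSF G (mem_filter.1 hG).1 h2 ((subset_insert _ _).trans h1)⟩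

lemma Sweep.cnt_eq (h : Sweep 𝓕 F R) (h' : Sweep 𝓕 F R') (hd : ∀ G ∈ 𝓕, G.card = d) (k : ℕ) :
    cnt 𝓕 R k = cnt 𝓕 R' k :=
  cnt_unique (d := d) k (fun j _ => by rw [← h.f_eq hd, ← h'.f_eq hd]) k le_rfl

lemma Sweep.cntint_eq (h : Sweep 𝓕 F R) (h' : Sweep 𝓕 F R') (hd : ∀ G ∈ 𝓕, G.card = d) (k : ℕ) :
    cnt 𝓕 (fun G => G \ R G) k = cnt 𝓕 (fun G => G \ R' G) k :=
  cnt_unique (d := d) k (fun j _ => by rw [← h.fint_eq hd, ← h'.fint_eq hd]) k le_rfl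

lemma Sweep.cntl_eq (h : Sweep 𝓕 F R) (h' : Sweep 𝓕 F R') (hd : ∀ G ∈ 𝓕, G.card = d) (v : α) (k : ℕ) :
    cnt (𝓕.filter (fun G => v ∈ G)) (fun G => insert v (R G)) k =
    cnt (𝓕.filter (fun G => v ∈ G)) (fun G => insert v (R' G)) k :=
  cnt_unique (d := d) k (fun j _ => by rw [← h.fl_eq hd, ← h'.fl_eq hd]) k le_rfl

lemma Sweep.cntlint_eq (h : Sweep 𝓕 F R) (h' : Sweep 𝓕 F R') (hd : ∀ G ∈ 𝓕, G.card = d) (v : α) (k : ℕ) :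
    cnt (𝓕.filter (fun G => v ∈ G)) (fun G => insert v (G \ R G)) k =
    cnt (𝓕.filter (fun G => v ∈ G)) (fun G => insert v (G \ R' G)) k :=
  cnt_unique (d := d) k (fun j _ => by rw [← h.flint_eq hd, ← h'.flint_eq hd]) k le_rfl

lemma Sweep.cntl_symm (h : Sweep 𝓕 F R) (hd : ∀ G ∈ 𝓕, G.card = d) {v : α} (hv : v ∉ F) (k : ℕ) :
    cnt (𝓕.filter (fun G => v ∈ G)) (fun G => insert v (G \ R G)) k =
    cnt (𝓕.filter (fun G => v ∈ G)) (fun G => insert v (R G)) k := by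
  refine cnt_unique (d := d) k (fun j _ => ?_) k le_rfl
  rw [← h.fl_eq hd, ← h.flint_eq hd]
  congr 1
  refine filter_congr fun S _ => ?_
  exact ⟨fun h => h.1, fun h => ⟨h, fun h2 => hv (h2 h)⟩⟩

/-- double counting over vertices -/
lemma sum_links {r : Finset α → Finset α} (hV : ∀ G ∈ 𝓕, G ⊆ V) (hr : ∀ G ∈ 𝓕, r G ⊆ G)
    (hd : ∀ G ∈ 𝓕, G.card = d) (k : ℕ) :
    ∑ v ∈ V, cnt (𝓕.filter (fun G => v ∈ G)) (fun G => insert v (r G)) (k+1) =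
      (k+1) * cnt 𝓕 r (k+1) + (d - k) * cnt 𝓕 r k := by
  have h1 : ∀ v ∈ V, cnt (𝓕.filter (fun G => v ∈ G)) (fun G => insert v (r G)) (k+1) =
      ∑ G ∈ 𝓕, if v ∈ G ∧ (insert v (r G)).card = k+1 then 1 else 0 := by
    intro v _
    rw [cnt, filter_filter, card_filter]
  rw [sum_congr rfl h1, sum_comm]
  have h2 : ∀ G ∈ 𝓕, (∑ v ∈ V, if v ∈ G ∧ (insert v (r G)).card = k+1 then 1 else 0) =
      (if (r G).card = k+1 then (k+1) else 0) + (if (r G).card = k then d - k else 0) := by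
    intro G hG
    rw [← card_filter]
    have e : V.filter (fun v => v ∈ G ∧ (insert v (r G)).card = k+1) =
      (if (r G).card = k+1 then r G else ∅) ∪ (if (r G).card = k then G \ r G else ∅) := by
      ext v
      by_cases hv : v ∈ r G
      · have := hr G hG hv
        have := hV G hG this
        simp only [mem_filter, mem_union, insert_eq_of_mem hv]
        split_ifs <;> simp_all
      · by_cases hvG : v ∈ G
        · have := hV G hG hvG
          simp only [mem_filter, mem_union, card_insert_of_notMem hv]
          split_ifs <;> simp_all
        · simp only [mem_filter, mem_union]
          split_ifs <;> simp_all
    rw [e, card_union_of_disjoint]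
    · have := card_sdiff_of_subset (hr G hG)
      have := hd G hG
      split_ifs <;> (try simp only [card_empty]) <;> omega
    · split_ifs
      · omega
      all_goals simp
  rw [sum_congr rfl h2, sum_add_distrib, ← sum_filter, ← sum_filter, sum_const, sum_const, cnt, cnt]
  simp [mul_comm]

lemma multichoose_rec (N k : ℕ) : (k+1) * Nat.multichoose N (k+1) = (N + k) * Nat.multichoose N k := by
  rcases N with _ | N
  · rcases k with _ | k <;> simp [Nat.multichoose_zero_succ]
  · rw [Nat.multichoose_eq, Nat.multichoose_eq]
    have := Nat.add_one_mul_choose_eq (N + k) k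
    have e1 : N + 1 + (k+1) - 1 = N + k + 1 := by omega
    have e2 : N + 1 + k - 1 = N + k := by omega
    rw [e1, e2]
    rw [mul_comm, ← this]
    ring

/-- the identity -/
lemma choose_identity (N d j : ℕ) (hj : j ≤ d) :
    ∑ k ∈ range (j+1), (d - k).choose (j - k) * Nat.multichoose N k = (N + d).choose j := by
  induction d generalizing j with
  | zero =>
    obtain rfl : j = 0 := by omega
    simp
  | succ d ih =>
    have aux : ∀ D, ∑ k ∈ range (D+1), Nat.multichoose N k = (N + D).choose D := by
      intro D
      induction D with
      | zero => simp
      | succ D ih2 =>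
        rw [sum_range_succ, ih2]
        rcases N with _ | N
        · simp [Nat.multichoose_zero_succ]
        · rw [Nat.multichoose_eq]
          have e1 : N + 1 + (D+1) - 1 = N + 1 + D := by omega
          rw [e1, ← Nat.add_assoc (N+1) D 1, Nat.choose_succ_succ (N+1+D) D]
    rcases Nat.lt_or_ge d j with h | h
    · obtain rfl : j = d + 1 := by omega
      rw [← aux]
      exact sum_congr rfl fun k _ => by rw [Nat.choose_self, one_mul]
    · rcases j with _ | j
      · simp
      · have e : ∀ k ∈ range (j+1), (d+1-k).choose (j+1-k) * Nat.multichoose N k =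
          (d-k).choose (j-k) * Nat.multichoose N k + (d-k).choose (j+1-k) * Nat.multichoose N k := by
          intro k hk
          have := mem_range.1 hk
          have e1 : d + 1 - k = (d - k) + 1 := by omega
          have e2 : j + 1 - k = (j - k) + 1 := by omega
          rw [e1, e2, Nat.choose_succ_succ]
          ring
        rw [sum_range_succ, sum_congr rfl e, sum_add_distrib, ih j (by omega), ← Nat.add_assoc N d 1,
          Nat.choose_succ_succ, ← ih (j+1) h, sum_range_succ _ (j+1)]
        simp [add_assoc]

structure Core (d s : ℕ) (V F : Finset α) (𝓕 : Finset (Finset α)) : Prop where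
  ne : 𝓕.Nonempty
  subV : ∀ G ∈ 𝓕, G ⊆ V
  cardG : ∀ G ∈ 𝓕, G.card = d
  FV : F ⊆ V
  cardF : F.card = d + s
  sweep1 : ∀ v ∈ V, ∃ R, Sweep 𝓕 F R ∧ ∀ G ∈ 𝓕, v ∈ G → v ∉ R G
  sweep2 : ∀ v ∈ F, ∃ R, Sweep 𝓕 F R ∧ ∀ G ∈ 𝓕, v ∈ G → v ∈ R G

lemma cnt_insert_le {r : Finset α → Finset α} {v : α} (h : ∀ G ∈ 𝓕, v ∈ G → v ∉ r G) (k : ℕ) :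
    cnt (𝓕.filter (fun G => v ∈ G)) (fun G => insert v (r G)) (k+1) ≤ cnt 𝓕 r k := by
  unfold cnt
  refine card_le_card fun G hG => ?_
  simp only [mem_filter] at hG ⊢
  refine ⟨hG.1.1, ?_⟩
  have := hG.2
  rw [card_insert_of_notMem (h G hG.1.1 hG.1.2)] at this
  omega

lemma Core.bound1 (C : Core d s V F 𝓕) (hR : Sweep 𝓕 F R) (k : ℕ) (hk : k ≤ d) :
    cnt 𝓕 R k ≤ Nat.multichoose (V.card - d) k := by
  have hn : d + s ≤ V.card := C.cardF ▸ card_le_card C.FV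
  induction k with
  | zero =>
    have h0 := hR.f_eq C.cardG 0
    have h1 : (faces 𝓕 0).card ≤ 1 := by
      rw [card_le_one]
      intro a ha b hb
      have := (mem_faces.1 ha).2
      have := (mem_faces.1 hb).2
      simp_all
    simp at h0 ⊢
    omega
  | succ k ih =>
    have ih := ih (by omega)
    have h1 := sum_links C.subV hR.sub C.cardG k
    have h2 : ∑ v ∈ V, cnt (𝓕.filter (fun G => v ∈ G)) (fun G => insert v (R G)) (k+1) ≤
        V.card * cnt 𝓕 R k := by
      rw [← smul_eq_mul, ← sum_const]
      refine sum_le_sum fun v hv => ?_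
      obtain ⟨R', hR', hv'⟩ := C.sweep1 v hv
      rw [hR.cntl_eq hR' C.cardG, hR.cnt_eq hR' C.cardG]
      exact cnt_insert_le hv' k
    have h3 := multichoose_rec (V.card - d) k
    have h4 : (V.card - d + k) + (d - k) = V.card := by omega
    have h5 : (k+1) * cnt 𝓕 R (k+1) ≤ (V.card - d + k) * cnt 𝓕 R k := by
      rw [← h4, add_mul] at h2
      omega
    have h6 := Nat.mul_le_mul_left (V.card - d + k) ih
    refine Nat.le_of_mul_le_mul_left (c := 0 + (k+1)) ?_ (by omega)
    rw [zero_add, h3]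
    omega

lemma Core.bound2 (C : Core d s V F 𝓕) (hR : Sweep 𝓕 F R) (k : ℕ) (hk : k ≤ d) :
    cnt 𝓕 (fun G => G \ R G) k + Nat.multichoose s k ≤ Nat.multichoose (V.card - d) k := by
  have hn : d + s ≤ V.card := C.cardF ▸ card_le_card C.FV
  induction k with
  | zero =>
    have h0 := hR.fint_eq C.cardG 0
    have h1 : ((faces 𝓕 0).filter (fun S => ¬ S ⊆ F)).card = 0 := by
      rw [card_eq_zero, filter_eq_empty_iff]
      intro S hS
      have := (mem_faces.1 hS).2
      rw [card_eq_zero] at this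
      simp [this]
    simp at h0 ⊢
    rw [← h0]
    simpa using h1
  | succ k ih =>
    have ih := ih (by omega)
    have h1 := sum_links (r := fun G => G \ R G) C.subV (fun _ _ => sdiff_subset) C.cardG k
    have h2 : ∑ v ∈ V, cnt (𝓕.filter (fun G => v ∈ G)) (fun G => insert v (G \ R G)) (k+1) ≤
        (d + s) * cnt 𝓕 (fun G => G \ R G) k + (V.card - (d+s)) * Nat.multichoose (V.card - d) k := by
      rw [← sum_sdiff C.FV, add_comm]
      refine add_le_add ?_ ?_
      · rw [← C.cardF, ← smul_eq_mul, ← sum_const]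
        refine sum_le_sum fun v hv => ?_
        obtain ⟨R', hR', hv'⟩ := C.sweep2 v hv
        rw [hR.cntlint_eq hR' C.cardG, hR.cntint_eq hR' C.cardG]
        exact cnt_insert_le (fun G hG hvG => by simp [hv' G hG hvG]) k
      · rw [← C.cardF, ← card_sdiff_of_subset C.FV, ← smul_eq_mul, ← sum_const]
        refine sum_le_sum fun v hv => ?_
        obtain ⟨hvV, hvF⟩ := mem_sdiff.1 hv
        rw [hR.cntl_symm C.cardG hvF]
        obtain ⟨R', hR', hv'⟩ := C.sweep1 v hvV
        rw [hR.cntl_eq hR' C.cardG]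
        exact (cnt_insert_le hv' k).trans (C.bound1 hR' k (by omega))
    have h3 := multichoose_rec (V.card - d) k
    have h3' := multichoose_rec s k
    set B := Nat.multichoose (V.card - d) k
    set b := Nat.multichoose s k
    set x := cnt 𝓕 (fun G => G \ R G) k
    set y := cnt 𝓕 (fun G => G \ R G) (k+1)
    obtain ⟨e, he⟩ := Nat.exists_eq_add_of_le hn
    have e1 : V.card - (d + s) = e := by omega
    have e2 : V.card - d = s + e := by omega
    obtain ⟨q, rfl⟩ := Nat.exists_eq_add_of_le (show k ≤ d by omega)
    rw [e1] at h2
    rw [h1] at h2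
    rw [e2] at h3 ⊢
    have e3 : k + q - k = q := by omega
    rw [e3] at h2
    refine Nat.le_of_mul_le_mul_left (c := 0 + (k+1)) ?_ (by omega)
    rw [zero_add, mul_add, h3, h3']
    nlinarith

lemma cnt_compl (hR : Sweep 𝓕 F R) (hd : ∀ G ∈ 𝓕, G.card = d) {k : ℕ} (hk : k ≤ d) :
    cnt 𝓕 R (d - k) = cnt 𝓕 (fun G => G \ R G) k := by
  unfold cnt
  congr 1
  refine filter_congr fun G hG => ?_
  have h1 := card_sdiff_of_subset (hR.sub G hG)
  have h2 := card_le_card (hR.sub G hG)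
  have := hd G hG
  simp only
  omega

/-- Final combinatorial comparison -/
theorem Core.compare {β : Type*} [DecidableEq β] {V' F' : Finset β} {𝓕' : Finset (Finset β)}
    (C : Core d s V F 𝓕) (C' : Core d s V' F' 𝓕') (hn : V.card = V'.card) (hd3 : 3 ≤ d)
    (h1 : ∀ j ≤ (d-1)/2, (faces 𝓕' j).card = V'.card.choose j)
    (h2 : ∀ j ≤ d/2, ((faces 𝓕' j).filter (fun S => ¬ S ⊆ F')).card + (d+s).choose j =
      V'.card.choose j)
    {i : ℕ} (hi : (d-1)/2 ≤ i) (hid : i ≤ d) (heq : (faces 𝓕 i).card = (faces 𝓕' i).card) :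
    (faces 𝓕 ((d-1)/2)).card = V.card.choose ((d-1)/2) := by
  obtain ⟨v, hv⟩ : V.Nonempty := by
    have := card_le_card C.FV
    rw [C.cardF] at this
    rw [← card_pos]; omega
  obtain ⟨v', hv'⟩ : V'.Nonempty := by
    have := card_le_card C'.FV
    rw [C'.cardF] at this
    rw [← card_pos]; omega
  have hn' : d + s ≤ V'.card := C'.cardF ▸ card_le_card C'.FV
  obtain ⟨R, hR, -⟩ := C.sweep1 v hv
  obtain ⟨R', hR', -⟩ := C'.sweep1 v' hv'
  have a1 : ∀ k ≤ (d-1)/2, cnt 𝓕' R' k = Nat.multichoose (V'.card - d) k := by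
    refine cnt_unique (d := d) _ fun j hj => ?_
    rw [← hR'.f_eq C'.cardG, h1 j hj, choose_identity _ _ _ (by omega), Nat.sub_add_cancel (by omega)]
  have a2 : ∀ k ≤ d/2, cnt 𝓕' (fun G => G \ R' G) k + Nat.multichoose s k =
      Nat.multichoose (V'.card - d) k := by
    refine cnt_unique (d := d) _ fun j hj => ?_
    simp_rw [mul_add]
    rw [sum_add_distrib, ← hR'.fint_eq C'.cardG, choose_identity _ _ _ (by omega),
      choose_identity _ _ _ (by omega), Nat.sub_add_cancel (by omega), add_comm s d]
    exact h2 j hj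
  have a3 : ∀ k ≤ d, cnt 𝓕 R k ≤ cnt 𝓕' R' k := by
    intro k hk
    by_cases hkd : k ≤ (d-1)/2
    · rw [a1 k hkd, ← hn]
      exact C.bound1 hR k hk
    · have e : k = d - (d - k) := by omega
      rw [e, cnt_compl hR C.cardG (by omega), cnt_compl hR' C'.cardG (by omega)]
      have := a2 (d-k) (by omega)
      have h3 := C.bound2 hR (d-k) (by omega)
      rw [hn] at h3
      omega
  have a4 : ∀ k ∈ range (i+1), (d-k).choose (i-k) * cnt 𝓕 R k = (d-k).choose (i-k) * cnt 𝓕' R' k := by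
    rw [← sum_eq_sum_iff_of_le]
    · rw [← hR.f_eq C.cardG, ← hR'.f_eq C'.cardG, heq]
    · intro k hk
      exact Nat.mul_le_mul_left _ (a3 k (by have := mem_range.1 hk; omega))
  rw [hn, ← h1 _ le_rfl, hR.f_eq C.cardG, hR'.f_eq C'.cardG]
  refine sum_congr rfl fun k hk => ?_
  have hk' := mem_range.1 hk
  have := a4 k (mem_range.2 (by omega))
  rw [Nat.eq_of_mul_eq_mul_left (Nat.choose_pos (by omega)) this]

end Comb

section Geom
variable {d : ℕ}

structure FData (V F : Finset (Fin d → ℝ)) (𝓕 : Finset (Finset (Fin d → ℝ)))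
    (φ : Finset (Fin d → ℝ) → ((Fin d → ℝ) →ᵃ[ℝ] ℝ))
    (nb : Finset (Fin d → ℝ) → (Fin d → ℝ) → Finset (Fin d → ℝ)) : Prop where
  subV : ∀ G ∈ 𝓕, G ⊆ V
  cardG : ∀ G ∈ 𝓕, G.card = d
  FV : F ⊆ V
  Fnot : F ∉ 𝓕
  cardF : d ≤ F.card
  Fne : F ≠ V
  GneV : ∀ G ∈ 𝓕, G ≠ V
  pos : ∀ G, (G = F ∨ G ∈ 𝓕) → ∀ v ∈ V, 0 ≤ φ G v
  zero : ∀ G, (G = F ∨ G ∈ 𝓕) → ∀ v ∈ V, (φ G v = 0 ↔ v ∈ G)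
  nb_mem : ∀ G ∈ 𝓕, ∀ v ∈ G, nb G v = F ∨ nb G v ∈ 𝓕
  nb_sub : ∀ G ∈ 𝓕, ∀ v ∈ G, G.erase v ⊆ nb G v
  nb_not : ∀ G ∈ 𝓕, ∀ v ∈ G, v ∉ nb G v

noncomputable def key (φ : Finset (Fin d → ℝ) → ((Fin d → ℝ) →ᵃ[ℝ] ℝ)) (o : Fin d → ℝ)
    (G : Finset (Fin d → ℝ)) : (Fin d → ℝ) →ₗ[ℝ] ℝ :=
  (-(φ G o)⁻¹) • (φ G).linear

lemma key_apply (φ : Finset (Fin d → ℝ) → ((Fin d → ℝ) →ᵃ[ℝ] ℝ)) (o : Fin d → ℝ)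
    (G : Finset (Fin d → ℝ)) (u) : key φ o G u = - ((φ G).linear u / φ G o) := by
  simp [key]; ring

lemma lin_sub (f : (Fin d → ℝ) →ᵃ[ℝ] ℝ) (x y : Fin d → ℝ) : f.linear (x - y) = f x - f y := by
  have := f.linearMap_vsub x y
  simpa using this

variable {V F : Finset (Fin d → ℝ)} {𝓕 : Finset (Finset (Fin d → ℝ))}
    {φ : Finset (Fin d → ℝ) → ((Fin d → ℝ) →ᵃ[ℝ] ℝ)}
    {nb : Finset (Fin d → ℝ) → (Fin d → ℝ) → Finset (Fin d → ℝ)}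

lemma FData.nb_pos (D : FData V F 𝓕 φ nb) {G} (hG : G ∈ 𝓕) {v} (hv : v ∈ G) : 0 < φ (nb G v) v := by
  have h1 := D.pos _ (D.nb_mem G hG v hv) v (D.subV G hG hv)
  have h2 := D.zero _ (D.nb_mem G hG v hv) v (D.subV G hG hv)
  exact lt_of_le_of_ne h1 fun h => D.nb_not G hG v hv (h2.1 h.symm)

lemma FData.nb_zero (D : FData V F 𝓕 φ nb) {G} (hG : G ∈ 𝓕) {v w} (hv : v ∈ G) (hw : w ∈ G)
    (hne : w ≠ v) : φ (nb G v) w = 0 :=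
  (D.zero _ (D.nb_mem G hG v hv) w (D.subV G hG hw)).2
    (D.nb_sub G hG v hv (mem_erase.2 ⟨hne, hw⟩))

lemma FData.span (D : FData V F 𝓕 φ nb) {o} (ho : ∀ G, (G = F ∨ G ∈ 𝓕) → 0 < φ G o)
    {G} (hG : G ∈ 𝓕) (u : Fin d → ℝ) : ∃ μ : (Fin d → ℝ) → ℝ, u = ∑ v ∈ G, μ v • (v - o) := by
  have hli : LinearIndependent ℝ (fun v : G => (v : Fin d → ℝ) - o) := by
    rw [Fintype.linearIndependent_iff]
    intro g hg v
    have h1 := D.nb_mem G hG v v.2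
    let L : (Fin d → ℝ) →ₗ[ℝ] ℝ := (φ G o) • (φ (nb G v)).linear - (φ (nb G v) o) • (φ G).linear
    have hL := congrArg L hg
    rw [map_sum, map_zero] at hL
    have hLv : ∀ w : G, L ((w : Fin d → ℝ) - o) = φ G o * φ (nb G v) w := by
      intro w
      have h0 := (D.zero G (Or.inr hG) w (D.subV G hG w.2)).2 w.2
      simp only [L, LinearMap.sub_apply, LinearMap.smul_apply, lin_sub, h0, smul_eq_mul]
      ring
    rw [Finset.sum_eq_single v] at hL
    · rw [map_smul, hLv, smul_eq_mul] at hL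
      have := ho G (Or.inr hG)
      have := D.nb_pos hG v.2
      have h3 : φ G o * φ (nb G v) v ≠ 0 := by positivity
      exact (mul_eq_zero.1 hL).resolve_right h3
    · intro w _ hw
      rw [map_smul, hLv, D.nb_zero hG v.2 w.2 (fun h => hw (Subtype.ext h))]
      simp
    · simp
  have hsp := hli.span_eq_top_of_card_eq_finrank' (by simp [D.cardG G hG])
  have hu : u ∈ Submodule.span ℝ (Set.range (fun v : G => (v : Fin d → ℝ) - o)) := by
    rw [hsp]; trivial
  rw [Submodule.mem_span_range_iff_exists_fun] at hu
  obtain ⟨c, hc⟩ := hu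
  refine ⟨fun v => if h : v ∈ G then c ⟨v, h⟩ else 0, ?_⟩
  rw [← hc, ← Finset.sum_coe_sort G]
  refine Finset.sum_congr rfl fun v _ => ?_
  simp

lemma FData.coord (D : FData V F 𝓕 φ nb) {o} (ho : ∀ G, (G = F ∨ G ∈ 𝓕) → 0 < φ G o)
    {G} (hG : G ∈ 𝓕) (u : Fin d → ℝ) : ∃ μ : (Fin d → ℝ) → ℝ,
      (∀ G', (G' = F ∨ G' ∈ 𝓕) → key φ o G u - key φ o G' u = ∑ v ∈ G, μ v * (φ G' v / φ G' o)) ∧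
      ∀ v ∈ G, key φ o G u - key φ o (nb G v) u = μ v * (φ (nb G v) v / φ (nb G v) o) := by
  obtain ⟨μ, hμ⟩ := D.span ho hG u
  have h1 : ∀ G', (G' = F ∨ G' ∈ 𝓕) → key φ o G' u = ∑ v ∈ G, μ v * (1 - φ G' v / φ G' o) := by
    intro G' hG'
    conv_lhs => rw [hμ]
    rw [map_sum]
    refine Finset.sum_congr rfl fun v _ => ?_
    rw [map_smul, key_apply, lin_sub, smul_eq_mul]
    have := ho G' hG'
    field_simp
    ring
  have h2 : ∀ G', (G' = F ∨ G' ∈ 𝓕) → key φ o G u - key φ o G' u = ∑ v ∈ G, μ v * (φ G' v / φ G' o) := by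
    intro G' hG'
    rw [h1 G (Or.inr hG), h1 G' hG', ← Finset.sum_sub_distrib]
    refine Finset.sum_congr rfl fun v hv => ?_
    rw [(D.zero G (Or.inr hG) v (D.subV G hG hv)).2 hv]
    ring
  refine ⟨μ, h2, fun v hv => ?_⟩
  rw [h2 _ (D.nb_mem G hG v hv), Finset.sum_eq_single v]
  · intro w hw hne
    rw [D.nb_zero hG hv hw hne]; simp
  · exact fun h => absurd hv h

/-- vertices across which the key increases -/
noncomputable def RR (φ : Finset (Fin d → ℝ) → ((Fin d → ℝ) →ᵃ[ℝ] ℝ))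
    (nb : Finset (Fin d → ℝ) → (Fin d → ℝ) → Finset (Fin d → ℝ)) (o u : Fin d → ℝ)
    (G : Finset (Fin d → ℝ)) : Finset (Fin d → ℝ) :=
  G.filter (fun v => key φ o G u < key φ o (nb G v) u)

lemma FData.local_opt (D : FData V F 𝓕 φ nb) {o u} (ho : ∀ G, (G = F ∨ G ∈ 𝓕) → 0 < φ G o)
    (gen : ∀ G ∈ 𝓕, ∀ v ∈ G, key φ o (nb G v) u ≠ key φ o G u)
    {G S} (hG : G ∈ 𝓕) (hR : RR φ nb o u G ⊆ S) {G'} (hG' : G' = F ∨ G' ∈ 𝓕)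
    (hS' : S ⊆ G') : key φ o G' u ≤ key φ o G u ∧ (key φ o G' u = key φ o G u → G ⊆ G') := by
  obtain ⟨μ, h1, h2⟩ := D.coord ho hG u
  have hterm : ∀ v ∈ G, 0 ≤ μ v * (φ G' v / φ G' o) ∧ (μ v * (φ G' v / φ G' o) = 0 → v ∈ G') := by
    intro v hv
    have hvV := D.subV G hG hv
    have z := D.zero G' hG' v hvV
    have p := D.pos G' hG' v hvV
    have po := ho G' hG'
    by_cases hvS : v ∈ G'
    · rw [z.2 hvS]; simp [hvS]
    · have hvR : v ∉ RR φ nb o u G := fun h => hvS (hS' (hR h))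
      simp only [RR, mem_filter, not_and, not_lt] at hvR
      have hk := lt_of_le_of_ne (hvR hv) (gen G hG v hv)
      have h3 := h2 v hv
      have h4 := D.nb_pos hG hv
      have h5 := ho _ (D.nb_mem G hG v hv)
      have hμ : 0 < μ v := by
        have h6 : 0 < μ v * (φ (nb G v) v / φ (nb G v) o) := by rw [← h3]; linarith
        exact pos_of_mul_pos_left h6 (by positivity)
      have p' : 0 < φ G' v := lt_of_le_of_ne p fun h => hvS (z.1 h.symm)
      have : 0 < μ v * (φ G' v / φ G' o) := by positivity
      exact ⟨this.le, fun h => absurd h this.ne'⟩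
  have h3 := h1 G' hG'
  constructor
  · have := Finset.sum_nonneg fun v hv => (hterm v hv).1
    linarith
  · intro he v hv
    rw [he, sub_self] at h3
    exact (hterm v hv).2 ((Finset.sum_eq_zero_iff_of_nonneg fun v hv => (hterm v hv).1).1 h3.symm v hv)

lemma FData.opt_unique (D : FData V F 𝓕 φ nb) {o u} (ho : ∀ G, (G = F ∨ G ∈ 𝓕) → 0 < φ G o)
    (gen : ∀ G ∈ 𝓕, ∀ v ∈ G, key φ o (nb G v) u ≠ key φ o G u)
    {G G' S} (hG : G ∈ 𝓕) (hG' : G' ∈ 𝓕) (hS : S ⊆ G) (hS' : S ⊆ G')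
    (hR : RR φ nb o u G ⊆ S) (hR' : RR φ nb o u G' ⊆ S) : G = G' := by
  have h1 := D.local_opt ho gen hG hR (Or.inr hG') hS'
  have h2 := D.local_opt ho gen hG' hR' (Or.inr hG) hS
  exact Finset.eq_of_subset_of_card_le (h1.2 (le_antisymm h1.1 h2.1))
    (by rw [D.cardG G hG, D.cardG G' hG'])

lemma FData.opt_exists (D : FData V F 𝓕 φ nb) {o u}
    {S G0} (hG0 : G0 ∈ 𝓕) (hS0 : S ⊆ G0)
    (hF : ¬ S ⊆ F ∨ ∀ G ∈ 𝓕, key φ o F u < key φ o G u) :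
    ∃ G, G ∈ 𝓕 ∧ S ⊆ G ∧ RR φ nb o u G ⊆ S := by
  obtain ⟨G, hG, hmax⟩ := Finset.exists_max_image ((insert F 𝓕).filter (fun G => S ⊆ G))
    (fun G => key φ o G u) ⟨G0, by simp [hG0, hS0]⟩
  simp only [mem_filter, mem_insert] at hG hmax
  have hGF : G ∈ 𝓕 := by
    rcases hG.1 with rfl | h
    · rcases hF with h | h
      · exact absurd hG.2 h
      · exact absurd (hmax G0 ⟨Or.inr hG0, hS0⟩) (not_le.2 (h G0 hG0))
    · exact h
  refine ⟨G, hGF, hG.2, fun v hv => ?_⟩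
  simp only [RR, mem_filter] at hv
  by_contra hvS
  refine absurd (hmax (nb G v) ⟨D.nb_mem G hGF v hv.1, fun w hw => D.nb_sub G hGF v hv.1 ?_⟩) (not_le.2 hv.2)
  exact mem_erase.2 ⟨fun h => hvS (h ▸ hw), hG.2 hw⟩

lemma FData.sweep (D : FData V F 𝓕 φ nb) {o u} (ho : ∀ G, (G = F ∨ G ∈ 𝓕) → 0 < φ G o)
    (hF : ∀ G ∈ 𝓕, key φ o F u < key φ o G u)
    (gen : ∀ G ∈ 𝓕, ∀ v ∈ G, key φ o (nb G v) u ≠ key φ o G u) :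
    Sweep 𝓕 F (RR φ nb o u) := by
  have gen' : ∀ G ∈ 𝓕, ∀ v ∈ G, key φ o (nb G v) (-u) ≠ key φ o G (-u) := by
    intro G hG v hv
    rw [map_neg, map_neg]
    exact fun h => gen G hG v hv (neg_injective h)
  have hc : ∀ G ∈ 𝓕, G \ RR φ nb o u G = RR φ nb o (-u) G := by
    intro G hG
    ext v
    simp only [RR, mem_sdiff, mem_filter, map_neg, neg_lt_neg_iff, not_and, not_lt]
    constructor
    · exact fun h => ⟨h.1, lt_of_le_of_ne (h.2 h.1) (gen G hG v h.1)⟩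
    · exact fun h => ⟨h.1, fun _ => h.2.le⟩
  refine ⟨fun G _ => filter_subset _ _, ?_, ?_, ?_⟩
  · intro S G0 hG0 hS0
    obtain ⟨G, a, b, c⟩ := D.opt_exists (o := o) (u := u) hG0 hS0 (Or.inr hF)
    exact ⟨G, ⟨a, b, c⟩, fun G' h => D.opt_unique ho gen h.1 a h.2.1 b h.2.2 c⟩
  · intro S G0 hG0 hS0 hSF
    obtain ⟨G, a, b, c⟩ := D.opt_exists (o := o) (u := -u) hG0 hS0 (Or.inl hSF)
    refine ⟨G, ⟨a, b, by simpa only [hc G a] using c⟩, fun G' h => ?_⟩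
    have h3 := h.2.2
    rw [hc G' h.1] at h3
    exact D.opt_unique ho gen' h.1 a h.2.1 b h3 c
  · intro S hSF G hG hSG hsub
    rw [hc G hG] at hsub
    have := (D.local_opt ho gen' hG hsub (Or.inl rfl) hSF).1
    rw [map_neg, map_neg] at this
    linarith [hF G hG]

open Filter Topology in
lemma FData.perturb (D : FData V F 𝓕 φ nb) {o u0} (ho : ∀ G, (G = F ∨ G ∈ 𝓕) → 0 < φ G o)
    (hF : ∀ G ∈ 𝓕, key φ o F u0 < key φ o G u0) :
    ∃ w : Fin d → ℝ, ∀ᶠ ε in 𝓝[>] (0:ℝ), Sweep 𝓕 F (RR φ nb o (u0 + ε • w)) := by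
  let ι := {p : Finset (Fin d → ℝ) × (Fin d → ℝ) // p ∈ 𝓕 ×ˢ V ∧ p.2 ∈ p.1}
  have hfin : Finite ι := by
    have : Finite {p : Finset (Fin d → ℝ) × (Fin d → ℝ) // p ∈ 𝓕 ×ˢ V} := inferInstance
    exact Finite.of_injective (fun p : ι => (⟨p.1, p.2.1⟩ : {p // p ∈ 𝓕 ×ˢ V}))
      (fun a b h => Subtype.ext (by simpa using h))
  obtain ⟨w, hw⟩ := Module.Dual.exists_forall_ne_zero_of_forall_exists
    (fun p : ι => (key φ o p.1.1 - key φ o (nb p.1.1 p.1.2) : Module.Dual ℝ (Fin d → ℝ))) (by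
      rintro ⟨⟨G, v⟩, hp, hv⟩
      simp only [mem_product] at hp hv
      refine ⟨v - o, ?_⟩
      have h1 := ho _ (D.nb_mem G hp.1 v hv)
      have h2 := ho _ (Or.inr hp.1)
      have h3 := (D.zero G (Or.inr hp.1) v hp.2).2 hv
      have h4 := D.nb_pos hp.1 hv
      simp only [LinearMap.sub_apply, key_apply, lin_sub, h3]
      have : -((0 - φ G o) / φ G o) - -((φ (nb G v) v - φ (nb G v) o) / φ (nb G v) o) =
        φ (nb G v) v / φ (nb G v) o := by field_simp; ring
      rw [this]
      positivity)
  refine ⟨w, ?_⟩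
  have e1 : ∀ᶠ ε in 𝓝[>] (0:ℝ), ∀ G ∈ 𝓕, key φ o F (u0 + ε • w) < key φ o G (u0 + ε • w) := by
    rw [eventually_all_finset]
    intro G hG
    apply Filter.Eventually.filter_mono nhdsWithin_le_nhds
    simp only [map_add, map_smul, smul_eq_mul]
    apply ContinuousAt.eventually_lt (by fun_prop) (by fun_prop)
    simpa using hF G hG
  have e2 : ∀ᶠ ε in 𝓝[>] (0:ℝ), ∀ G ∈ 𝓕, ∀ v ∈ G, key φ o (nb G v) (u0 + ε • w) ≠ key φ o G (u0 + ε • w) := by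
    rw [eventually_all_finset]
    intro G hG
    rw [eventually_all_finset]
    intro v hv
    have hne := hw ⟨(G, v), by simp [hG, D.subV G hG hv], hv⟩
    simp only [LinearMap.sub_apply] at hne
    simp only [map_add, map_smul, smul_eq_mul]
    by_cases h0 : key φ o (nb G v) u0 = key φ o G u0
    · filter_upwards [self_mem_nhdsWithin] with ε (hε : 0 < ε)
      rw [h0]
      intro h
      have : ε * (key φ o G w - key φ o (nb G v) w) = 0 := by linarith
      rcases mul_eq_zero.1 this with h | h
      · exact hε.ne' h
      · exact hne h
    · apply Filter.Eventually.filter_mono nhdsWithin_le_nhds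
      have h : ∀ᶠ ε in 𝓝 (0:ℝ), (key φ o (nb G v) u0 + ε * key φ o (nb G v) w)
        - (key φ o G u0 + ε * key φ o G w) ≠ 0 :=
        ContinuousAt.eventually_ne (by fun_prop) (by simpa [sub_eq_zero] using h0)
      exact h.mono fun ε h h2 => h (by linarith)
  filter_upwards [e1, e2] with ε h1 h2
  exact D.sweep ho h1 h2

lemma avg_apply (f : (Fin d → ℝ) →ᵃ[ℝ] ℝ) (A : Finset (Fin d → ℝ)) (hA : A.Nonempty) :
    f ((A.card : ℝ)⁻¹ • ∑ v ∈ A, v) = (A.card : ℝ)⁻¹ * ∑ v ∈ A, f v := by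
  have h0 : (A.card : ℝ) ≠ 0 := by simpa using hA.ne_empty
  have h : ∀ x, f x = f.linear x + f 0 := fun x => by have := lin_sub f x 0; simp at this; linarith
  rw [h, map_smul, map_sum]
  rw [Finset.sum_congr rfl (fun v _ => h v), Finset.sum_add_distrib]
  simp
  field_simp

lemma avg_pos (f : (Fin d → ℝ) →ᵃ[ℝ] ℝ) (A : Finset (Fin d → ℝ)) (h0 : ∀ v ∈ A, 0 ≤ f v)
    (h1 : ∃ v ∈ A, f v ≠ 0) : 0 < f ((A.card : ℝ)⁻¹ • ∑ v ∈ A, v) := by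
  obtain ⟨v, hv, hne⟩ := h1
  rw [avg_apply f A ⟨v, hv⟩]
  have : 0 < A.card := card_pos.2 ⟨v, hv⟩
  have h2 : 0 < ∑ v ∈ A, f v :=
    Finset.sum_pos' h0 ⟨v, hv, lt_of_le_of_ne (h0 v hv) hne.symm⟩
  positivity

lemma FData.points (D : FData V F 𝓕 φ nb) (hd : 0 < d) : ∃ x c : Fin d → ℝ,
    φ F x = 0 ∧ (∀ G ∈ 𝓕, 0 < φ G x) ∧ (∀ G, (G = F ∨ G ∈ 𝓕) → 0 < φ G c) := by
  have hFne : F.Nonempty := by rw [← card_pos]; have := D.cardF; omega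
  refine ⟨(F.card : ℝ)⁻¹ • ∑ v ∈ F, v, (V.card : ℝ)⁻¹ • ∑ v ∈ V, v, ?_, ?_, ?_⟩
  · rw [avg_apply _ _ hFne, Finset.sum_eq_zero, mul_zero]
    intro v hv
    exact (D.zero F (Or.inl rfl) v (D.FV hv)).2 hv
  · intro G hG
    apply avg_pos
    · exact fun v hv => D.pos G (Or.inr hG) v (D.FV hv)
    · by_contra! h
      have hsub : F ⊆ G := fun v hv => (D.zero G (Or.inr hG) v (D.FV hv)).1 (h v hv)
      have := Finset.eq_of_subset_of_card_le hsub (by rw [D.cardG G hG]; exact D.cardF)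
      exact D.Fnot (this ▸ hG)
  · intro G hG
    apply avg_pos
    · exact fun v hv => D.pos G hG v hv
    · by_contra! h
      have hsub : V ⊆ G := fun v hv => (D.zero G hG v hv).1 (h v hv)
      rcases hG with rfl | hG
      · exact D.Fne (D.FV.antisymm hsub)
      · exact D.GneV G hG ((D.subV G hG).antisymm hsub)

open Filter Topology in
lemma FData.sweep1 (D : FData V F 𝓕 φ nb) (hd : 0 < d) {v} (hv : v ∈ V) :
    ∃ R, Sweep 𝓕 F R ∧ ∀ G ∈ 𝓕, v ∈ G → v ∉ R G := by
  obtain ⟨x, c, hx0, hx, hc⟩ := D.points hd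
  have ev : ∀ (f : (Fin d → ℝ) →ᵃ[ℝ] ℝ) (κ : ℝ), f (x + κ • (c - x)) = f x + κ * (f c - f x) := by
    intro f κ
    have := lin_sub f (x + κ • (c - x)) x
    rw [add_sub_cancel_left, map_smul, lin_sub, smul_eq_mul] at this
    linarith
  have el : ∀ (f : (Fin d → ℝ) →ᵃ[ℝ] ℝ) (κ : ℝ), f.linear ((v - x) + κ • (c - x)) =
      f v - f x + κ * (f c - f x) := by
    intro f κ
    rw [map_add, map_smul, lin_sub, lin_sub, smul_eq_mul]
  have klt : ∀ (o u : Fin d → ℝ) (A B : Finset (Fin d → ℝ)), 0 < φ A o → 0 < φ B o →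
      (φ B).linear u * φ A o < (φ A).linear u * φ B o → key φ o A u < key φ o B u := by
    intro o u A B hA hB h
    rw [key_apply, key_apply, neg_lt_neg_iff, div_lt_div_iff₀ hB hA]
    exact h
  have hκ : ∀ᶠ κ in 𝓝[>] (0:ℝ),
      (∀ G, (G = F ∨ G ∈ 𝓕) → 0 < φ G (x + (κ^2) • (c - x))) ∧
      (∀ G ∈ 𝓕, key φ (x + (κ^2) • (c - x)) F ((v - x) + κ • (c - x)) <
        key φ (x + (κ^2) • (c - x)) G ((v - x) + κ • (c - x))) ∧
      (∀ G ∈ 𝓕, v ∈ G → key φ (x + (κ^2) • (c - x)) (nb G v) ((v - x) + κ • (c - x)) <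
        key φ (x + (κ^2) • (c - x)) G ((v - x) + κ • (c - x))) := by
    have i0 : ∀ᶠ κ in 𝓝[>] (0:ℝ), 0 < κ ∧ κ < 1 := by
      filter_upwards [Ioo_mem_nhdsGT (show (0:ℝ) < 1 by norm_num)] with κ h using h
    have i1 : ∀ᶠ κ in 𝓝[>] (0:ℝ), ∀ G, (G = F ∨ G ∈ 𝓕) → 0 < φ G (x + (κ^2) • (c - x)) := by
      filter_upwards [i0] with κ h G hG
      rw [ev]
      have h1 := hc G hG
      have h2 : 0 ≤ φ G x := by
        rcases hG with rfl | hG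
        · exact hx0.ge
        · exact (hx G hG).le
      have h3 : κ^2 < 1 := by nlinarith
      have h4 : 0 < κ^2 := by nlinarith
      nlinarith
    have i2 : ∀ᶠ κ in 𝓝[>] (0:ℝ), ∀ G ∈ 𝓕,
        (φ G v - φ G x + κ * (φ G c - φ G x)) * (κ * φ F c) < φ F c * (φ G x + κ^2 * (φ G c - φ G x)) := by
      rw [eventually_all_finset]
      intro G hG
      apply Filter.Eventually.filter_mono nhdsWithin_le_nhds
      apply ContinuousAt.eventually_lt (by fun_prop) (by fun_prop)
      have := mul_pos (hc F (Or.inl rfl)) (hx G hG)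
      simpa using this
    have i3 : ∀ᶠ κ in 𝓝[>] (0:ℝ), ∀ G ∈ 𝓕, v ∈ G →
        (φ G v - φ G x + κ * (φ G c - φ G x)) * (φ (nb G v) x + κ^2 * (φ (nb G v) c - φ (nb G v) x)) <
        (φ (nb G v) v - φ (nb G v) x + κ * (φ (nb G v) c - φ (nb G v) x)) *
          (φ G x + κ^2 * (φ G c - φ G x)) := by
      rw [eventually_all_finset]
      intro G hG
      rw [eventually_imp_distrib_left]
      intro hvG
      apply Filter.Eventually.filter_mono nhdsWithin_le_nhds
      apply ContinuousAt.eventually_lt (by fun_prop) (by fun_prop)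
      have := mul_pos (D.nb_pos hG hvG) (hx G hG)
      rw [(D.zero G (Or.inr hG) v hv).2 hvG]
      simp
      nlinarith
    filter_upwards [i0, i1, i2, i3] with κ h0 h1 h2 h3
    refine ⟨h1, fun G hG => klt _ _ _ _ (h1 F (Or.inl rfl)) (h1 G (Or.inr hG)) ?_,
      fun G hG hvG => klt _ _ _ _ (h1 _ (D.nb_mem G hG v hvG)) (h1 G (Or.inr hG)) ?_⟩
    · rw [el, el, ev, ev, hx0]
      have a1 := h2 G hG
      have a2 := D.pos F (Or.inl rfl) v hv
      have a3 := h1 G (Or.inr hG)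
      rw [ev] at a3
      have a4 := mul_nonneg a2 a3.le
      have a5 := mul_lt_mul_of_pos_left a1 h0.1
      nlinarith
    · rw [el, el, ev, ev]
      exact h3 G hG hvG
  obtain ⟨κ, ho, h1, h2⟩ := hκ.exists
  obtain ⟨w, hw⟩ := D.perturb ho h1
  set o := x + (κ^2) • (c - x)
  set u0 := (v - x) + κ • (c - x)
  have h3 : ∀ᶠ ε in 𝓝[>] (0:ℝ), ∀ G ∈ 𝓕, v ∈ G → key φ o (nb G v) (u0 + ε • w) < key φ o G (u0 + ε • w) := by
    rw [eventually_all_finset]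
    intro G hG
    rw [eventually_imp_distrib_left]
    intro hvG
    apply Filter.Eventually.filter_mono nhdsWithin_le_nhds
    simp only [map_add, map_smul, smul_eq_mul]
    apply ContinuousAt.eventually_lt (by fun_prop) (by fun_prop)
    simpa using h2 G hG hvG
  obtain ⟨ε, hs, h⟩ := (hw.and h3).exists
  refine ⟨_, hs, fun G hG hvG hR => ?_⟩
  simp only [RR, mem_filter] at hR
  exact lt_asymm hR.2 (h G hG hvG)

open Filter Topology in
lemma FData.sweep2 (D : FData V F 𝓕 φ nb) (hd : 0 < d) {v} (hv : v ∈ F) :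
    ∃ R, Sweep 𝓕 F R ∧ ∀ G ∈ 𝓕, v ∈ G → v ∈ R G := by
  obtain ⟨x, c, hx0, hx, hc⟩ := D.points hd
  have ek : ∀ G, (G = F ∨ G ∈ 𝓕) → ∀ κ : ℝ, key φ c G (-((v - c) + κ • (x - c))) =
      -(1 + κ) + (φ G v + κ * φ G x) / φ G c := by
    intro G hG κ
    have := hc G hG
    rw [key_apply, map_neg, map_add, map_smul, lin_sub, lin_sub, smul_eq_mul]
    field_simp
    ring
  have h1 : ∀ κ : ℝ, 0 < κ → ∀ G ∈ 𝓕, key φ c F (-((v - c) + κ • (x - c))) <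
      key φ c G (-((v - c) + κ • (x - c))) := by
    intro κ hκ G hG
    rw [ek F (Or.inl rfl), ek G (Or.inr hG), hx0, (D.zero F (Or.inl rfl) v (D.FV hv)).2 hv]
    have a1 := hc G (Or.inr hG)
    have a2 := hx G hG
    have a3 := D.pos G (Or.inr hG) v (D.FV hv)
    have : 0 < (φ G v + κ * φ G x) / φ G c := by positivity
    simpa using this
  have h2 : ∀ᶠ κ in 𝓝[>] (0:ℝ), ∀ G ∈ 𝓕, v ∈ G →
      key φ c G (-((v - c) + κ • (x - c))) < key φ c (nb G v) (-((v - c) + κ • (x - c))) := by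
    rw [eventually_all_finset]
    intro G hG
    rw [eventually_imp_distrib_left]
    intro hvG
    apply Filter.Eventually.filter_mono nhdsWithin_le_nhds
    simp only [ek G (Or.inr hG), ek _ (D.nb_mem G hG v hvG)]
    apply ContinuousAt.eventually_lt (by fun_prop) (by fun_prop)
    rw [(D.zero G (Or.inr hG) v (D.FV hv)).2 hvG]
    have a1 := hc _ (D.nb_mem G hG v hvG)
    have a2 := D.nb_pos hG hvG
    have : 0 < φ (nb G v) v / φ (nb G v) c := by positivity
    simpa using this
  obtain ⟨κ, h2, hκ⟩ := (h2.and (self_mem_nhdsWithin (s := Set.Ioi (0:ℝ)))).exists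
  obtain ⟨w, hw⟩ := D.perturb hc (h1 κ hκ)
  set u0 := (-((v - c) + κ • (x - c)))
  have h3 : ∀ᶠ ε in 𝓝[>] (0:ℝ), ∀ G ∈ 𝓕, v ∈ G → key φ c G (u0 + ε • w) < key φ c (nb G v) (u0 + ε • w) := by
    rw [eventually_all_finset]
    intro G hG
    rw [eventually_imp_distrib_left]
    intro hvG
    apply Filter.Eventually.filter_mono nhdsWithin_le_nhds
    simp only [map_add, map_smul, smul_eq_mul]
    apply ContinuousAt.eventually_lt (by fun_prop) (by fun_prop)
    simpa using h2 G hG hvG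
  obtain ⟨ε, hs, h⟩ := (hw.and h3).exists
  refine ⟨_, hs, fun G hG hvG => ?_⟩
  simp only [RR, mem_filter]
  exact ⟨hvG, h G hG hvG⟩

lemma FData.core (D : FData V F 𝓕 φ nb) (hd : 0 < d) (hne : 𝓕.Nonempty) {s : ℕ}
    (hs : F.card = d + s) : Core d s V F 𝓕 :=
  ⟨hne, D.subV, D.cardG, D.FV, hs, fun _ hv => D.sweep1 hd hv, fun _ hv => D.sweep2 hd hv⟩

end Geom

section Poly
variable {d : ℕ}

def Sup (V Z : Finset (Fin d → ℝ)) : Prop := Z ⊆ V ∧ Z ≠ V ∧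
  ∃ φ : (Fin d → ℝ) →ᵃ[ℝ] ℝ, ∀ v ∈ V, 0 ≤ φ v ∧ (φ v = 0 ↔ v ∈ Z)

def Fct (V Z : Finset (Fin d → ℝ)) : Prop := Sup V Z ∧
  ∀ ψ : (Fin d → ℝ) →ᵃ[ℝ] ℝ, (∀ v ∈ Z, ψ v = 0) → ∀ w ∈ V, w ∉ Z → ψ w = 0 → ∀ v ∈ V, ψ v = 0

variable {V F Z : Finset (Fin d → ℝ)}

lemma sep {S : Set (Fin d → ℝ)} {x : Fin d → ℝ} (hx : x ∉ affineSpan ℝ S) :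
    ∃ ψ : (Fin d → ℝ) →ᵃ[ℝ] ℝ, (∀ y ∈ S, ψ y = 0) ∧ ψ x = 1 := by
  rcases S.eq_empty_or_nonempty with rfl | ⟨p, hp⟩
  · exact ⟨AffineMap.const ℝ _ 1, by simp, by simp⟩
  have h1 : x - p ∉ (affineSpan ℝ S).direction := by
    intro h
    apply hx
    have := AffineSubspace.vadd_mem_of_mem_direction h (mem_affineSpan ℝ hp)
    simpa using this
  obtain ⟨f, hf, hle⟩ := Submodule.exists_le_ker_of_notMem h1
  refine ⟨(f (x - p))⁻¹ • (f.toAffineMap - AffineMap.const ℝ _ (f p)), ?_, ?_⟩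
  · intro y hy
    have : y - p ∈ (affineSpan ℝ S).direction :=
      AffineSubspace.vsub_mem_direction (mem_affineSpan ℝ hy) (mem_affineSpan ℝ hp)
    have := hle this
    rw [LinearMap.mem_ker, map_sub] at this
    simp [this]
  · simp only [map_sub] at hf
    simp [hf]

lemma Sup.of_fun (φ : (Fin d → ℝ) →ᵃ[ℝ] ℝ) (h0 : ∀ v ∈ V, 0 ≤ φ v) (h1 : ∃ v ∈ V, φ v ≠ 0) :
    Sup V (V.filter (fun v => φ v = 0)) := by
  refine ⟨filter_subset _ _, ?_, φ, fun v hv => ⟨h0 v hv, by simp [hv]⟩⟩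
  obtain ⟨v, hv, h⟩ := h1
  intro he
  rw [← he] at hv
  exact h (mem_filter.1 hv).2

lemma Sup.inter {Z' : Finset (Fin d → ℝ)} (h : Sup V Z) (h' : Sup V Z') : Sup V (Z ∩ Z') := by
  obtain ⟨a, b, φ, hφ⟩ := h
  obtain ⟨a', b', φ', hφ'⟩ := h'
  refine ⟨inter_subset_left.trans a, ?_, φ + φ', fun v hv => ?_⟩
  · intro he
    exact b (a.antisymm (he ▸ inter_subset_left))
  · have h1 := hφ v hv
    have h2 := hφ' v hv
    simp only [AffineMap.coe_add, Pi.add_apply, mem_inter, ← h1.2, ← h2.2]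
    refine ⟨by linarith, ?_⟩
    constructor
    · intro h; constructor <;> linarith
    · intro h; linarith

/-- the tilting argument -/
lemma Sup.tilt (h : Sup V Z) (ψ : (Fin d → ℝ) →ᵃ[ℝ] ℝ) (hψ : ∀ v ∈ Z, 0 ≤ ψ v)
    (hne : ∃ w ∈ V, w ∉ Z ∧ True) :
    ∃ φ' : (Fin d → ℝ) →ᵃ[ℝ] ℝ, (∀ v ∈ V, 0 ≤ φ' v) ∧ (∀ v ∈ Z, φ' v = ψ v) ∧
      (∃ w ∈ V, w ∉ Z ∧ φ' w = 0) := by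
  obtain ⟨a, b, φ, hφ⟩ := h
  obtain ⟨w0, hw0, hw0', -⟩ := hne
  obtain ⟨w, hw, hmax⟩ := Finset.exists_max_image (V \ Z) (fun w => -(ψ w) / φ w) ⟨w0, by simp [hw0, hw0']⟩
  rw [mem_sdiff] at hw
  have hpos : ∀ v ∈ V, v ∉ Z → 0 < φ v := fun v hv hz =>
    lt_of_le_of_ne (hφ v hv).1 fun h => hz ((hφ v hv).2.1 h.symm)
  refine ⟨ψ + (-(ψ w) / φ w) • φ, ?_, ?_, w, hw.1, hw.2, ?_⟩
  · intro v hv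
    simp only [AffineMap.coe_add, Pi.add_apply, AffineMap.coe_smul, Pi.smul_apply, smul_eq_mul]
    by_cases hz : v ∈ Z
    · rw [(hφ v hv).2.2 hz]; simp [hψ v hz]
    · have h1 := hmax v (by simp [hv, hz])
      have h2 := hpos v hv hz
      rw [div_le_iff₀ h2] at h1
      linarith
  · intro v hv
    simp [(hφ v (a hv)).2.2 hv]
  · have := hpos w hw.1 hw.2
    simp only [AffineMap.coe_add, Pi.add_apply, AffineMap.coe_smul, Pi.smul_apply, smul_eq_mul]
    field_simp
    ring

lemma Sup.exists_out (h : Sup V Z) : ∃ w ∈ V, w ∉ Z := by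
  by_contra! hh
  exact h.2.1 (h.1.antisymm hh)

lemma Sup.extend (h : Sup V Z) : ∃ G, Fct V G ∧ Z ⊆ G := by
  classical
  obtain ⟨G, hG, hmax⟩ := Finset.exists_max_image (V.powerset.filter (fun G => Sup V G ∧ Z ⊆ G))
    Finset.card ⟨Z, by simp [h, h.1]⟩
  simp only [mem_filter, mem_powerset] at hG hmax
  refine ⟨G, ⟨hG.2.1, ?_⟩, hG.2.2⟩
  by_contra! hc
  obtain ⟨ψ, h0, w, hw, hwG, hψw, v, hv, hne⟩ := hc
  have key : ∀ ψ : (Fin d → ℝ) →ᵃ[ℝ] ℝ, (∀ v ∈ G, ψ v = 0) → ψ w = 0 → 0 < ψ v → False := by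
    intro ψ h0 hψw hpos
    obtain ⟨a, b, φ, hφ⟩ := hG.2.1
    obtain ⟨u, hu, hmin⟩ := Finset.exists_min_image (V.filter (fun v => 0 < ψ v)) (fun v => φ v / ψ v)
      ⟨v, by simp [hv, hpos]⟩
    simp only [mem_filter] at hu hmin
    have e : ∀ x, (φ - (φ u / ψ u) • ψ) x = φ x - φ u / ψ u * ψ x := by intro x; simp
    have hw1 : φ w ≠ 0 := fun h => hwG ((hφ w hw).2.1 h)
    have hS := Sup.of_fun (V := V) (φ - (φ u / ψ u) • ψ) (by
      intro x hx
      rw [e]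
      have h1 := (hφ x hx).1
      have h2 := (hφ u hu.1).1
      have h3 : 0 ≤ φ u / ψ u := div_nonneg h2 hu.2.le
      by_cases hx0 : 0 < ψ x
      · have := hmin x ⟨hx, hx0⟩
        rw [le_div_iff₀ hx0] at this
        linarith
      · nlinarith) ⟨w, hw, by rw [e, hψw]; simpa using hw1⟩
    have hsub : G ⊂ V.filter (fun v => (φ - (φ u / ψ u) • ψ) v = 0) := by
      rw [Finset.ssubset_iff_of_subset]
      · refine ⟨u, ?_, ?_⟩
        · rw [mem_filter, e]
          refine ⟨hu.1, ?_⟩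
          have := hu.2.ne'
          field_simp; ring
        · intro huG
          have := h0 u huG
          linarith [hu.2]
      · intro x hx
        rw [mem_filter, e, h0 x hx, (hφ x (a hx)).2.2 hx]
        exact ⟨a hx, by simp⟩
    have := hmax _ ⟨filter_subset _ _, hS, hG.2.2.trans hsub.1⟩
    exact absurd (card_lt_card hsub) (not_lt.2 this)
  rcases lt_or_gt_of_ne hne with hlt | hgt
  · exact key (-ψ) (by simpa using h0) (by simpa using hψw) (by simpa using hlt)
  · exact key ψ h0 hψw hgt

structure ASPd (V F : Finset (Fin d → ℝ)) : Prop where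
  vert : verts (convexHull ℝ (V : Set (Fin d → ℝ))) = V
  span : ∀ ψ : (Fin d → ℝ) →ᵃ[ℝ] ℝ, (∀ v ∈ V, ψ v = 0) → ψ = 0
  fct : Fct V F
  simp : ∀ G, Fct V G → G ≠ F → G.card = d

lemma span_top (span : ∀ ψ : (Fin d → ℝ) →ᵃ[ℝ] ℝ, (∀ v ∈ V, ψ v = 0) → ψ = 0) {S : Set (Fin d → ℝ)}
    (h : ∀ ψ : (Fin d → ℝ) →ᵃ[ℝ] ℝ, (∀ v ∈ S, ψ v = 0) → ∀ v ∈ V, ψ v = 0) :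
    affineSpan ℝ S = ⊤ := by
  rw [eq_top_iff]
  intro x _
  by_contra hx
  obtain ⟨ψ, h0, h1⟩ := sep hx
  have := span ψ (h ψ h0)
  rw [this] at h1
  simp at h1

lemma Sup.notMem (h : Sup V Z) {w} (hw : w ∈ V) (hwZ : w ∉ Z) :
    w ∉ affineSpan ℝ (Z : Set (Fin d → ℝ)) := by
  obtain ⟨a, b, φ, hφ⟩ := h
  intro hmem
  have : ∀ x ∈ affineSpan ℝ (Z : Set (Fin d → ℝ)), φ x = 0 := by
    intro x hx
    refine affineSpan_induction (p := fun x => φ x = 0) hx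
      (fun x hx => (hφ x (a hx)).2.2 hx) fun c u v w hu hv hw => ?_
    simp only [vsub_eq_sub, vadd_eq_add]
    have := lin_sub φ (c • (u - v) + w) w
    rw [add_sub_cancel_right, map_smul, lin_sub, hu, hv, hw] at this
    simpa using this.symm
  exact hwZ ((hφ w hw).2.1 (this w hmem))

lemma finrank_lt (h : Sup V Z) (hd : 0 < d) :
    Module.finrank ℝ (affineSpan ℝ (Z : Set (Fin d → ℝ))).direction < d := by
  rcases Z.eq_empty_or_nonempty with rfl | hne
  · rw [Finset.coe_empty, direction_affineSpan, vectorSpan_empty, finrank_bot]; exact hd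
  obtain ⟨w, hw, hwZ⟩ := h.exists_out
  have h1 := h.notMem hw hwZ
  have := Submodule.finrank_le (affineSpan ℝ (Z : Set (Fin d → ℝ))).direction
  simp only [Module.finrank_fin_fun] at this
  refine lt_of_le_of_ne this fun he => h1 ?_
  have : (affineSpan ℝ (Z : Set (Fin d → ℝ))).direction = ⊤ :=
    Submodule.eq_top_of_finrank_eq (by simpa using he)
  rw [AffineSubspace.direction_eq_top_iff_of_nonempty] at this
  · rw [this]; trivial
  · exact (affineSpan_nonempty ℝ).2 (by simpa using hne)

lemma dim_of_fct (span : ∀ ψ : (Fin d → ℝ) →ᵃ[ℝ] ℝ, (∀ v ∈ V, ψ v = 0) → ψ = 0)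
    (h : Fct V Z) (hd : 0 < d) :
    Module.finrank ℝ (affineSpan ℝ (Z : Set (Fin d → ℝ))).direction = d - 1 := by
  obtain ⟨w, hw, hwZ⟩ := h.1.exists_out
  have h1 := finrank_lt h.1 hd
  have h2 : affineSpan ℝ (insert w (Z : Set (Fin d → ℝ))) = ⊤ := by
    apply span_top span
    intro ψ hψ
    exact h.2 ψ (fun v hv => hψ v (by simp [hv])) w hw hwZ (hψ w (by simp))
  have h3 := finrank_vectorSpan_insert_le_set ℝ (Z : Set (Fin d → ℝ)) w
  rw [← direction_affineSpan ℝ (insert _ _), h2, AffineSubspace.direction_top, finrank_top,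
    Module.finrank_fin_fun, ← direction_affineSpan] at h3
  omega

lemma fct_of_dim (h : Sup V Z) (hd : 0 < d) (hZ : Z.Nonempty)
    (hdim : Module.finrank ℝ (affineSpan ℝ (Z : Set (Fin d → ℝ))).direction = d - 1) : Fct V Z := by
  refine ⟨h, fun ψ h0 w hw hwZ hψw v hv => ?_⟩
  have h1 := h.notMem hw hwZ
  have h2 : affineSpan ℝ (insert w (Z : Set (Fin d → ℝ))) = ⊤ := by
    have hlt : affineSpan ℝ (Z : Set (Fin d → ℝ)) < affineSpan ℝ (insert w (Z : Set (Fin d → ℝ))) := by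
      refine lt_of_le_of_ne (affineSpan_mono ℝ (by simp)) fun he => h1 ?_
      rw [he]; exact mem_affineSpan ℝ (by simp)
    have h3 := AffineSubspace.direction_lt_of_nonempty hlt ((affineSpan_nonempty ℝ).2 (by simpa using hZ))
    have h4 := Submodule.finrank_lt_finrank_of_lt h3
    have h5 := Submodule.finrank_le (affineSpan ℝ (insert w (Z : Set (Fin d → ℝ)))).direction
    simp only [Module.finrank_fin_fun] at h5
    have : (affineSpan ℝ (insert w (Z : Set (Fin d → ℝ)))).direction = ⊤ :=
      Submodule.eq_top_of_finrank_eq (by simp; omega)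
    rwa [AffineSubspace.direction_eq_top_iff_of_nonempty] at this
    exact (affineSpan_nonempty ℝ).2 (by simp)
  have : ∀ x ∈ affineSpan ℝ (insert w (Z : Set (Fin d → ℝ))), ψ x = 0 := by
    intro x hx
    refine affineSpan_induction (p := fun x => ψ x = 0) hx ?_ fun c u v w hu hv hw => ?_
    · intro x hx
      rcases hx with rfl | hx
      · exact hψw
      · exact h0 x hx
    simp only [vsub_eq_sub, vadd_eq_add]
    have := lin_sub ψ (c • (u - v) + w) w
    rw [add_sub_cancel_right, map_smul, lin_sub, hu, hv, hw] at this
    simpa using this.symm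
  exact this v (by rw [h2]; trivial)

lemma indep_of_fct (span : ∀ ψ : (Fin d → ℝ) →ᵃ[ℝ] ℝ, (∀ v ∈ V, ψ v = 0) → ψ = 0)
    (h : Fct V Z) (hd : 0 < d) (hc : Z.card = d) :
    AffineIndependent ℝ ((↑) : Z → (Fin d → ℝ)) := by
  have h1 := dim_of_fct span h hd
  rw [affineIndependent_iff_finrank_vectorSpan_eq ℝ _ (n := d - 1) (by simp; omega),
    ← direction_affineSpan]
  rw [Subtype.range_coe_subtype]
  exact h1

lemma ASPd.exists_nb (A : ASPd V F) (hd : 0 < d) {G} (hG : Fct V G) (hGF : G ≠ F) {v} (hv : v ∈ G) :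
    ∃ G', Fct V G' ∧ G.erase v ⊆ G' ∧ v ∉ G' := by
  have hi := indep_of_fct A.span hG hd (A.simp G hG hGF)
  have h1 : v ∉ affineSpan ℝ ((G.erase v : Finset _) : Set (Fin d → ℝ)) := by
    have := hi.notMem_affineSpan_sdiff ⟨v, hv⟩ Set.univ
    convert this using 3
    ext x
    simp
    tauto
  obtain ⟨ψ, h0, hψv⟩ := sep h1
  obtain ⟨w, hw, hwG⟩ := hG.1.exists_out
  obtain ⟨φ', p1, p2, w, hw, hwG, hφw⟩ := hG.1.tilt ψ (by
    intro x hx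
    by_cases hxv : x = v
    · rw [hxv, hψv]; simp
    · exact (h0 x (by simp [hx, hxv])).ge) ⟨w, hw, hwG, trivial⟩
  have hvV := hG.1.1 hv
  have hφv : φ' v = 1 := by rw [p2 v hv, hψv]
  refine ⟨V.filter (fun v => φ' v = 0), ⟨Sup.of_fun φ' p1 ⟨v, hvV, by rw [hφv]; simp⟩, ?_⟩, ?_, ?_⟩
  · intro χ hχ w1 hw1 hw1' hχw
    have := hG.2 (χ - (χ v) • φ') (by
      intro x hx
      by_cases hxv : x = v
      · rw [hxv]; simp [hφv]
      · have e1 : φ' x = 0 := by rw [p2 x hx]; exact h0 x (by simp [hx, hxv])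
        simp [e1, hχ x (by simp [e1, hG.1.1 hx])]) w hw hwG (by
        simp [hφw, hχ w (by simp [hφw, hw])])
    have h2 := this w1 hw1
    simp only [mem_filter, not_and] at hw1'
    simp [hχw, hw1' hw1] at h2
    intro x hx
    have h3 := this x hx
    simpa [h2] using h3
  · intro x hx
    have hx' := mem_erase.1 hx
    rw [mem_filter]
    exact ⟨hG.1.1 hx'.2, by rw [p2 x hx'.2]; exact h0 x (by simpa using hx'.symm)⟩
  · simp [hφv]

open Classical in
noncomputable def fam (V F : Finset (Fin d → ℝ)) : Finset (Finset (Fin d → ℝ)) :=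
  V.powerset.filter (fun G => Fct V G ∧ G ≠ F)

lemma mem_fam {G} : G ∈ fam V F ↔ Fct V G ∧ G ≠ F := by
  classical
  simp only [fam, mem_filter, mem_powerset]
  exact ⟨fun h => h.2, fun h => ⟨h.1.1.1, h⟩⟩

open Classical in
noncomputable def phi (V : Finset (Fin d → ℝ)) (G : Finset (Fin d → ℝ)) : (Fin d → ℝ) →ᵃ[ℝ] ℝ :=
  if h : Sup V G then h.2.2.choose else 0

lemma phi_spec (h : Sup V Z) : ∀ v ∈ V, 0 ≤ phi V Z v ∧ (phi V Z v = 0 ↔ v ∈ Z) := by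
  rw [phi, dif_pos h]
  exact h.2.2.choose_spec

open Classical in
noncomputable def nbr (V : Finset (Fin d → ℝ)) (G : Finset (Fin d → ℝ)) (v : Fin d → ℝ) :
    Finset (Fin d → ℝ) :=
  if h : ∃ G', Fct V G' ∧ G.erase v ⊆ G' ∧ v ∉ G' then h.choose else ∅

lemma ASPd.nbr_spec (A : ASPd V F) (hd : 0 < d) {G} (hG : Fct V G) (hGF : G ≠ F) {v} (hv : v ∈ G) :
    Fct V (nbr V G v) ∧ G.erase v ⊆ nbr V G v ∧ v ∉ nbr V G v := by
  have h := A.exists_nb hd hG hGF hv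
  rw [nbr, dif_pos h]
  exact h.choose_spec

lemma fct_card' (span : ∀ ψ : (Fin d → ℝ) →ᵃ[ℝ] ℝ, (∀ v ∈ V, ψ v = 0) → ψ = 0)
    (hd : 0 < d) {G} (hG : Fct V G) : d ≤ G.card := by
  have h1 := dim_of_fct span hG hd
  rcases G.eq_empty_or_nonempty with rfl | hne
  · obtain ⟨w, hw, hwZ⟩ := hG.1.exists_out
    have h2 : affineSpan ℝ ({w} : Set (Fin d → ℝ)) = ⊤ := by
      apply span_top span
      intro ψ hψ
      exact hG.2 ψ (by simp) w hw hwZ (hψ w (by simp))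
    have := congrArg AffineSubspace.direction h2
    rw [direction_affineSpan, vectorSpan_singleton, AffineSubspace.direction_top] at this
    have h3 : Module.finrank ℝ (⊥ : Submodule ℝ (Fin d → ℝ)) = d := by
      rw [this, finrank_top, Module.finrank_fin_fun]
    rw [finrank_bot] at h3
    omega
  · have h3 := finrank_vectorSpan_range_le ℝ ((↑) : G → (Fin d → ℝ)) (n := G.card - 1) (by
      have := card_pos.2 hne
      simp; omega)
    rw [← direction_affineSpan, Subtype.range_coe_subtype] at h3
    change Module.finrank ℝ (affineSpan ℝ (G : Set (Fin d → ℝ))).direction ≤ _ at h3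
    have := card_pos.2 hne
    omega

lemma ASPd.fct_card (A : ASPd V F) (hd : 0 < d) {G} (hG : Fct V G) : d ≤ G.card :=
  fct_card' A.span hd hG

lemma ASPd.fdata (A : ASPd V F) (hd : 0 < d) : FData V F (fam V F) (phi V) (nbr V) := by
  have hS : ∀ G, (G = F ∨ G ∈ fam V F) → Fct V G := by
    rintro G (rfl | h)
    · exact A.fct
    · exact (mem_fam.1 h).1
  have hn : ∀ G ∈ fam V F, ∀ v ∈ G, _ := fun G hG v hv =>
    A.nbr_spec hd (mem_fam.1 hG).1 (mem_fam.1 hG).2 hv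
  exact
  { subV := fun G hG => (mem_fam.1 hG).1.1.1
    cardG := fun G hG => A.simp G (mem_fam.1 hG).1 (mem_fam.1 hG).2
    FV := A.fct.1.1
    Fnot := fun h => (mem_fam.1 h).2 rfl
    cardF := A.fct_card hd A.fct
    Fne := A.fct.1.2.1
    GneV := fun G hG => (mem_fam.1 hG).1.1.2.1
    pos := fun G hG v hv => (phi_spec (hS G hG).1 v hv).1
    zero := fun G hG v hv => (phi_spec (hS G hG).1 v hv).2
    nb_mem := fun G hG v hv => by
      by_cases h : nbr V G v = F
      · exact Or.inl h
      · exact Or.inr (mem_fam.2 ⟨(hn G hG v hv).1, h⟩)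
    nb_sub := fun G hG v hv => (hn G hG v hv).2.1
    nb_not := fun G hG v hv => (hn G hG v hv).2.2 }

/-- every proper supported set other than `F` lies in a member of the family -/
lemma ASPd.cover (A : ASPd V F) {S} (hS : Sup V S) (hne : S ≠ F) : ∃ G ∈ fam V F, S ⊆ G := by
  by_cases hSF : S ⊆ F
  · have hss : S ⊂ F := lt_of_le_of_ne hSF hne
    obtain ⟨x, hxF, hxS⟩ := Finset.exists_of_ssubset hss
    obtain ⟨w, hw, hwF⟩ := A.fct.1.exists_out
    obtain ⟨φ', p1, p2, w, hw, hwF, hφw⟩ := A.fct.1.tilt (phi V S)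
      (fun v hv => (phi_spec hS v (A.fct.1.1 hv)).1) ⟨w, hw, hwF, trivial⟩
    have hx : φ' x ≠ 0 := by
      rw [p2 x hxF]
      exact fun h => hxS ((phi_spec hS x (A.fct.1.1 hxF)).2.1 h)
    obtain ⟨G, hG, hsub⟩ := (Sup.of_fun φ' p1 ⟨x, A.fct.1.1 hxF, hx⟩).extend
    refine ⟨G, mem_fam.2 ⟨hG, fun h => hwF (h ▸ hsub (by simp [hw, hφw]))⟩, fun y hy => hsub ?_⟩
    rw [mem_filter]
    exact ⟨hS.1 hy, by rw [p2 y (hSF hy)]; exact (phi_spec hS y (hS.1 hy)).2.2 hy⟩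
  · obtain ⟨G, hG, hsub⟩ := hS.extend
    exact ⟨G, mem_fam.2 ⟨hG, fun h => hSF (h ▸ hsub)⟩, hsub⟩

lemma ASPd.sub_sup (A : ASPd V F) (hd : 0 < d) {G S} (hG : G ∈ fam V F) (hS : S ⊆ G) : Sup V S := by
  have hG' := mem_fam.1 hG
  have key : ∀ B : Finset (Fin d → ℝ), B ⊆ G → Sup V (G \ B) := by
    intro B
    induction B using Finset.induction_on with
    | empty => intro _; simpa using hG'.1.1
    | insert a B ha ih =>
      intro h
      have haG : a ∈ G := h (by simp)
      have h1 := ih (fun x hx => h (by simp [hx]))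
      have h2 := A.nbr_spec hd hG'.1 hG'.2 haG
      have h3 := h1.inter h2.1.1
      convert h3 using 1
      ext x
      simp only [mem_sdiff, mem_insert, mem_inter, not_or]
      constructor
      · rintro ⟨a1, a2, a3⟩
        exact ⟨⟨a1, a3⟩, h2.2.1 (mem_erase.2 ⟨a2, a1⟩)⟩
      · rintro ⟨⟨a1, a3⟩, a2⟩
        exact ⟨a1, fun h => h2.2.2 (h ▸ a2), a3⟩
  have := key (G \ S) sdiff_subset
  rwa [Finset.sdiff_sdiff_eq_self hS] at this

lemma ASPd.fam_ne (A : ASPd V F) (hd : 0 < d) : (fam V F).Nonempty := by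
  obtain ⟨x, hx⟩ : F.Nonempty := by rw [← card_pos]; have := A.fct_card hd A.fct; omega
  obtain ⟨w, hw, hwF⟩ := A.fct.1.exists_out
  obtain ⟨φ', p1, p2, w, hw, hwF, hφw⟩ := A.fct.1.tilt (AffineMap.const ℝ _ 1)
      (fun v hv => by simp) ⟨w, hw, hwF, trivial⟩
  have hS := Sup.of_fun φ' p1 ⟨x, A.fct.1.1 hx, by rw [p2 x hx]; simp⟩
  obtain ⟨G, hG, -⟩ := A.cover hS (fun h => hwF (by rw [← h]; simp [hw, hφw]))
  exact ⟨G, hG⟩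

lemma ASPd.core (A : ASPd V F) (hd : 0 < d) {s : ℕ} (hs : F.card = d + s) :
    Core d s V F (fam V F) := (A.fdata hd).core hd (A.fam_ne hd) hs

end Poly

section Faces
variable {d : ℕ} {V F Z : Finset (Fin d → ℝ)}

def affOf (b : Fin d → ℝ) (c : ℝ) : (Fin d → ℝ) →ᵃ[ℝ] ℝ :=
  AffineMap.const ℝ _ c - (Fintype.linearCombination ℝ b).toAffineMap

lemma affOf_apply (b : Fin d → ℝ) (c : ℝ) (x) : affOf b c x = c - dotp b x := by
  simp [affOf, Fintype.linearCombination_apply, dotp, mul_comm]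

lemma exists_affOf (φ : (Fin d → ℝ) →ᵃ[ℝ] ℝ) : ∃ b c, φ = affOf b c := by
  refine ⟨fun i => - φ.linear (Pi.single i 1), φ 0, ?_⟩
  ext x
  rw [affOf_apply]
  have h := lin_sub φ x 0
  rw [sub_zero] at h
  have h2 : φ.linear x = ∑ i, x i * φ.linear (Pi.single i 1) := by
    conv_lhs => rw [pi_eq_sum_univ' x, map_sum]
    refine Finset.sum_congr rfl fun i _ => ?_
    rw [map_smul, smul_eq_mul]
  simp only [dotp, neg_mul, Finset.sum_neg_distrib]
  rw [Finset.sum_congr rfl (fun i _ => mul_comm _ (x i)), ← h2]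
  linarith

lemma aff_comb (φ : (Fin d → ℝ) →ᵃ[ℝ] ℝ) (x y : Fin d → ℝ) {a b : ℝ} (hab : a + b = 1) :
    φ (a • x + b • y) = a * φ x + b * φ y := by
  have := Convex.combo_affine_apply (f := φ) (x := x) (y := y) hab
  simpa using this

lemma conv_nonneg {φ : (Fin d → ℝ) →ᵃ[ℝ] ℝ} (h : ∀ v ∈ V, 0 ≤ φ v) :
    ∀ x ∈ convexHull ℝ (V : Set (Fin d → ℝ)), 0 ≤ φ x := by
  have : convexHull ℝ (V : Set (Fin d → ℝ)) ⊆ {x | 0 ≤ φ x} := by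
    apply convexHull_min
    · exact fun v hv => h v hv
    · intro x hx y hy a b ha hb hab
      simp only [Set.mem_ofPred_eq] at *
      rw [aff_comb φ x y hab]
      positivity
  exact fun x hx => this hx

lemma conv_zero {φ : (Fin d → ℝ) →ᵃ[ℝ] ℝ} (h : ∀ v ∈ Z, φ v = 0) :
    ∀ x ∈ convexHull ℝ (Z : Set (Fin d → ℝ)), φ x = 0 := by
  have : convexHull ℝ (Z : Set (Fin d → ℝ)) ⊆ {x | φ x = 0} := by
    apply convexHull_min
    · exact fun v hv => h v hv
    · intro x hx y hy a b ha hb hab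
      simp only [Set.mem_ofPred_eq] at *
      rw [aff_comb φ x y hab, hx, hy]
      simp
  exact fun x hx => this hx

lemma sup_face {φ : (Fin d → ℝ) →ᵃ[ℝ] ℝ} (hZ : Z ⊆ V)
    (h : ∀ v ∈ V, 0 ≤ φ v ∧ (φ v = 0 ↔ v ∈ Z)) :
    {x ∈ convexHull ℝ (V : Set (Fin d → ℝ)) | φ x = 0} = convexHull ℝ (Z : Set (Fin d → ℝ)) := by
  have hz := conv_zero (φ := φ) (Z := Z) fun v hv => (h v (hZ hv)).2.2 hv
  apply Set.Subset.antisymm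
  · have : convexHull ℝ (V : Set (Fin d → ℝ)) ⊆ {x | 0 < φ x ∨ x ∈ convexHull ℝ (Z : Set (Fin d → ℝ))} := by
      apply convexHull_min
      · intro v hv
        by_cases hvZ : v ∈ Z
        · exact Or.inr (subset_convexHull ℝ _ hvZ)
        · exact Or.inl (lt_of_le_of_ne (h v hv).1 fun h0 => hvZ ((h v hv).2.1 h0.symm))
      · intro x hx y hy a b ha hb hab
        simp only [Set.mem_ofPred_eq] at *
        by_cases hxy : x ∈ convexHull ℝ (Z : Set (Fin d → ℝ)) ∧ y ∈ convexHull ℝ (Z : Set (Fin d → ℝ))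
        · exact Or.inr (convex_convexHull ℝ _ hxy.1 hxy.2 ha hb hab)
        have hx0 : 0 ≤ φ x := by
          rcases hx with hx | hx
          · exact hx.le
          · exact (hz x hx).ge
        have hy0 : 0 ≤ φ y := by
          rcases hy with hy | hy
          · exact hy.le
          · exact (hz y hy).ge
        rcases ha.eq_or_lt with rfl | ha
        · have hb1 : b = 1 := by linarith
          simpa [hb1] using hy
        rcases hb.eq_or_lt with rfl | hb
        · have hb1 : a = 1 := by linarith
          simpa [hb1] using hx
        left
        rw [aff_comb φ x y hab]
        rcases hx with hx | hx
        · positivity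
        · rcases hy with hy | hy
          · positivity
          · exact absurd ⟨hx, hy⟩ hxy
    rintro x ⟨hx, h0⟩
    rcases this hx with h1 | h1
    · exact absurd h0 h1.ne'
    · exact h1
  · intro x hx
    exact ⟨convexHull_mono (by exact_mod_cast hZ) hx, hz x hx⟩

lemma verts_sub (hV : verts (convexHull ℝ (V : Set (Fin d → ℝ))) = V) (hZ : Z ⊆ V) :
    verts (convexHull ℝ (Z : Set (Fin d → ℝ))) = Z := by
  apply Set.Subset.antisymm
  · exact extremePoints_convexHull_subset
  · intro z hz
    have : z ∈ verts (convexHull ℝ (V : Set (Fin d → ℝ))) := by rw [hV]; exact hZ hz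
    exact inter_extremePoints_subset_extremePoints_of_subset
      (convexHull_mono (s := (Z : Set (Fin d → ℝ))) (by exact_mod_cast hZ))
      ⟨subset_convexHull ℝ _ hz, this⟩

lemma conv_inj (hV : verts (convexHull ℝ (V : Set (Fin d → ℝ))) = V) {Z' : Finset (Fin d → ℝ)}
    (hZ : Z ⊆ V) (hZ' : Z' ⊆ V)
    (h : convexHull ℝ (Z : Set (Fin d → ℝ)) = convexHull ℝ (Z' : Set (Fin d → ℝ))) : Z = Z' := by
  have := verts_sub hV hZ
  rw [h, verts_sub hV hZ'] at this
  exact_mod_cast this.symm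

lemma face_sup {G} (h : IsFaceOf (convexHull ℝ (V : Set (Fin d → ℝ))) G) :
    G = ∅ ∨ G = convexHull ℝ (V : Set (Fin d → ℝ)) ∨
      ∃ Z, Sup V Z ∧ G = convexHull ℝ (Z : Set (Fin d → ℝ)) := by
  rcases h with h | h | ⟨b, c, -, hle, rfl⟩
  · exact Or.inl h
  · exact Or.inr (Or.inl h)
  right
  have e : ∀ x, dotp b x = c ↔ affOf b c x = 0 := by
    intro x; rw [affOf_apply, sub_eq_zero, eq_comm]
  have h0 : ∀ v ∈ V, 0 ≤ affOf b c v := by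
    intro v hv
    rw [affOf_apply]
    linarith [hle v (subset_convexHull ℝ _ hv)]
  have h1 := sup_face (φ := affOf b c) (V := V) (Z := V.filter (fun v => affOf b c v = 0))
    (filter_subset _ _) (fun v hv => ⟨h0 v hv, by simp [hv]⟩)
  simp only [e]
  rw [h1]
  by_cases hV : ∃ v ∈ V, affOf b c v ≠ 0
  · exact Or.inr ⟨_, Sup.of_fun _ h0 hV, rfl⟩
  · push Not at hV
    left
    rw [Finset.filter_true_of_mem hV]

lemma Sup.face (h : Sup V Z) : IsFaceOf (convexHull ℝ (V : Set (Fin d → ℝ)))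
    (convexHull ℝ (Z : Set (Fin d → ℝ))) := by
  rcases Z.eq_empty_or_nonempty with rfl | ⟨z, hz⟩
  · left; simp
  obtain ⟨w, hw, hwZ⟩ := h.exists_out
  obtain ⟨a, b, φ, hφ⟩ := h
  obtain ⟨b, c, rfl⟩ := exists_affOf φ
  right; right
  refine ⟨b, c, ?_, ?_, ?_⟩
  · rintro rfl
    have h1 := (hφ z (a hz)).2.2 hz
    have h2 := (hφ w hw).2.not.2 hwZ
    rw [affOf_apply] at h1 h2
    apply h2
    simp [dotp] at h1 ⊢
    exact h1
  · intro x hx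
    have := conv_nonneg (fun v hv => (hφ v hv).1) x hx
    rw [affOf_apply] at this
    linarith
  · rw [← sup_face a hφ]
    ext x
    simp only [affOf_apply, Set.mem_ofPred_eq, sub_eq_zero, eq_comm]

lemma polyDim_conv (Z : Set (Fin d → ℝ)) :
    polyDim (convexHull ℝ Z) = Module.finrank ℝ (affineSpan ℝ Z).direction := by
  rw [polyDim, affineSpan_convexHull]

lemma ASPd.dim_V (A : ASPd V F) : polyDim (convexHull ℝ (V : Set (Fin d → ℝ))) = d := by
  rw [polyDim_conv, span_top A.span (fun ψ h => h), AffineSubspace.direction_top, finrank_top,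
    Module.finrank_fin_fun]

lemma ASPd.dim_sub (A : ASPd V F) (hd : 0 < d) {G S} (hG : G ∈ fam V F) (hS : S ⊆ G)
    (hne : S.Nonempty) : polyDim (convexHull ℝ (S : Set (Fin d → ℝ))) + 1 = S.card := by
  have hG := mem_fam.1 hG
  have hi := indep_of_fct A.span hG.1 hd (A.simp G hG.1 hG.2)
  have hi' : AffineIndependent ℝ ((↑) : S → (Fin d → ℝ)) :=
    AffineIndependent.mono (s := (S : Set (Fin d → ℝ))) (t := (G : Set (Fin d → ℝ))) hi (by exact_mod_cast hS)
  have : Nonempty S := hne.to_subtype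
  have h1 := hi'.finrank_vectorSpan_add_one
  rw [← direction_affineSpan, Subtype.range_coe_subtype, Fintype.card_coe] at h1
  rw [polyDim_conv]
  exact h1

lemma ASPd.fVec_lt (A : ASPd V F) {i : ℕ} (h1 : 1 ≤ i) (hi : i < d) :
    fVec (convexHull ℝ (V : Set (Fin d → ℝ))) (i - 1) = (faces (fam V F) i).card := by
  have hd : 0 < d := by omega
  have hset : {F : Set (Fin d → ℝ) | IsFaceOf (convexHull ℝ (V : Set (Fin d → ℝ))) F ∧ F.Nonempty ∧
      polyDim F = i - 1} = (fun S : Finset (Fin d → ℝ) => convexHull ℝ (S : Set (Fin d → ℝ))) ''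
        (faces (fam V F) i : Set (Finset (Fin d → ℝ))) := by
    ext G
    simp only [Set.mem_ofPred_eq, Set.mem_image, Finset.mem_coe, mem_faces]
    constructor
    · rintro ⟨hf, hne, hdim⟩
      rcases face_sup hf with rfl | rfl | ⟨Z, hZ, rfl⟩
      · simp at hne
      · rw [A.dim_V] at hdim; omega
      · have hZF : Z ≠ F := by
          rintro rfl
          rw [polyDim_conv, dim_of_fct A.span A.fct hd] at hdim
          omega
        obtain ⟨G, hG, hs⟩ := A.cover hZ hZF
        refine ⟨Z, ⟨⟨G, hG, hs⟩, ?_⟩, rfl⟩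
        have := A.dim_sub hd hG hs (by simpa using hne)
        omega
    · rintro ⟨S, ⟨⟨G, hG, hs⟩, hc⟩, rfl⟩
      have hne : S.Nonempty := by rw [← card_pos]; omega
      refine ⟨(A.sub_sup hd hG hs).face, by simpa using hne, ?_⟩
      have := A.dim_sub hd hG hs hne
      omega
  rw [fVec, hset, Set.InjOn.ncard_image, Set.ncard_coe_finset]
  intro S hS S' hS' h
  simp only [Finset.mem_coe, mem_faces] at hS hS'
  obtain ⟨⟨G, hG, hs⟩, -⟩ := hS
  obtain ⟨⟨G', hG', hs'⟩, -⟩ := hS'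
  exact conv_inj A.vert (A.sub_sup hd hG hs).1 (A.sub_sup hd hG' hs').1 h

lemma ASPd.faces_d (A : ASPd V F) : faces (fam V F) d = fam V F := by
  ext S
  rw [mem_faces]
  constructor
  · rintro ⟨⟨G, hG, hs⟩, hc⟩
    have h := mem_fam.1 hG
    have := Finset.eq_of_subset_of_card_le hs (by rw [hc, A.simp G h.1 h.2])
    rwa [this]
  · intro h
    have h' := mem_fam.1 h
    exact ⟨⟨S, h, Subset.rfl⟩, A.simp S h'.1 h'.2⟩

lemma ASPd.fVec_d (A : ASPd V F) (hd : 0 < d) :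
    fVec (convexHull ℝ (V : Set (Fin d → ℝ))) (d - 1) = (faces (fam V F) d).card + 1 := by
  have hset : {F : Set (Fin d → ℝ) | IsFaceOf (convexHull ℝ (V : Set (Fin d → ℝ))) F ∧ F.Nonempty ∧
      polyDim F = d - 1} = (fun S : Finset (Fin d → ℝ) => convexHull ℝ (S : Set (Fin d → ℝ))) ''
        (insert F (fam V F) : Finset (Finset (Fin d → ℝ))) := by
    ext G
    simp only [Set.mem_ofPred_eq, Set.mem_image, Finset.mem_coe, mem_insert]
    constructor
    · rintro ⟨hf, hne, hdim⟩
      rcases face_sup hf with rfl | rfl | ⟨Z, hZ, rfl⟩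
      · simp at hne
      · rw [A.dim_V] at hdim; omega
      · refine ⟨Z, ?_, rfl⟩
        have hF := fct_of_dim hZ hd (by simpa using hne) (by rwa [polyDim_conv] at hdim)
        by_cases h : Z = F
        · exact Or.inl h
        · exact Or.inr (mem_fam.2 ⟨hF, h⟩)
    · rintro ⟨S, hS, rfl⟩
      have hF : Fct V S := by
        rcases hS with rfl | hS
        · exact A.fct
        · exact (mem_fam.1 hS).1
      have hne : S.Nonempty := by rw [← card_pos]; have := A.fct_card hd hF; omega
      exact ⟨hF.1.face, by simpa using hne, by rw [polyDim_conv, dim_of_fct A.span hF hd]⟩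
  rw [fVec, hset, Set.InjOn.ncard_image, Set.ncard_coe_finset, A.faces_d, card_insert_of_notMem]
  · exact fun h => (mem_fam.1 h).2 rfl
  intro S hS S' hS' h
  have hF : ∀ S, S ∈ insert F (fam V F) → S ⊆ V := by
    intro S hS
    rcases mem_insert.1 hS with rfl | hS
    · exact A.fct.1.1
    · exact (mem_fam.1 hS).1.1.1
  exact conv_inj A.vert (hF S hS) (hF S' hS') h

lemma exists_ASPd {P F0 : Set (Fin d → ℝ)} (hd : 0 < d) (h : IsASPPair P F0) :
    ∃ V F : Finset (Fin d → ℝ), P = convexHull ℝ (V : Set (Fin d → ℝ)) ∧ verts P = V ∧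
      verts F0 = F ∧ ASPd V F := by
  obtain ⟨⟨W, hW⟩, hdim, ⟨hFf, hFne, hFdim⟩, hs⟩ := h
  have hfin : (verts P).Finite := by
    rw [verts, hW]
    exact W.finite_toSet.subset extremePoints_convexHull_subset
  have hcl : P = convexHull ℝ (verts P) := by
    have hc : IsCompact P := by rw [hW]; exact W.finite_toSet.isCompact_convexHull ℝ
    have hcv : Convex ℝ P := by rw [hW]; exact convex_convexHull ℝ _
    have := closure_convexHull_extremePoints hc hcv
    exact this.symm.trans (hfin.isClosed_convexHull ℝ).closure_eq
  obtain ⟨V, hV⟩ := hfin.exists_finset_coe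
  rw [← hV] at hcl
  subst hcl
  have hspan : ∀ ψ : (Fin d → ℝ) →ᵃ[ℝ] ℝ, (∀ v ∈ V, ψ v = 0) → ψ = 0 := by
    intro ψ h0
    have hne : V.Nonempty := by
      by_contra hh
      rw [not_nonempty_iff_eq_empty] at hh
      rw [hh, polyDim_conv, Finset.coe_empty, direction_affineSpan, vectorSpan_empty, finrank_bot] at hdim
      omega
    rw [polyDim_conv] at hdim
    have : (affineSpan ℝ (V : Set (Fin d → ℝ))).direction = ⊤ :=
      Submodule.eq_top_of_finrank_eq (by simpa using hdim)
    rw [AffineSubspace.direction_eq_top_iff_of_nonempty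
      ((affineSpan_nonempty ℝ).2 (by simpa using hne))] at this
    ext x
    have hx : x ∈ affineSpan ℝ (V : Set (Fin d → ℝ)) := by rw [this]; trivial
    refine affineSpan_induction (p := fun x => ψ x = 0) hx h0 fun c u v w hu hv hw => ?_
    simp only [vsub_eq_sub, vadd_eq_add]
    have := lin_sub ψ (c • (u - v) + w) w
    rw [add_sub_cancel_right, map_smul, lin_sub, hu, hv, hw] at this
    simpa using this.symm
  have hV' := hV.symm
  rcases face_sup hFf with rfl | rfl | ⟨F, hF, rfl⟩
  · simp at hFne
  · omega
  refine ⟨V, F, rfl, hV', verts_sub hV' hF.1, hV', hspan, ?_, ?_⟩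
  · exact fct_of_dim hF hd (by simpa using hFne) (by rwa [polyDim_conv] at hFdim)
  · intro G hG hne
    have hGne : G.Nonempty := by
      rw [← card_pos]; have := fct_card' hspan hd hG; omega
    have := hs (convexHull ℝ (G : Set (Fin d → ℝ))) ⟨hG.1.face, by simpa using hGne,
      by rw [polyDim_conv, dim_of_fct hspan hG hd]⟩ (fun h => hne (conv_inj hV' hG.1.1 hF.1 h))
    rw [verts_sub hV' hG.1.1, Set.ncard_coe_finset] at this
    exact this

end Faces

section CurveSec
open Polynomial

def DD (f : ℝ → ℝ) (X : Finset ℝ) : ℝ := ∑ x ∈ X, f x / ∏ y ∈ X.erase x, (x - y)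

lemma DD_poly {q : ℝ[X]} {X : Finset ℝ} {d : ℕ} (hX : X.card = d + 1) (hq : q.degree < d) :
    DD (fun t => q.eval t) X = 0 := by
  have h : q.degree < (X.card : WithBot ℕ) := hq.trans (by rw [hX]; exact_mod_cast Nat.lt_succ_self d)
  have := Lagrange.coeff_eq_sum (s := X) (v := fun x => x) (fun _ _ _ _ h => h) h
  rw [DD, ← this, hX]
  exact Polynomial.coeff_eq_zero_of_degree_lt (by simpa using hq)

lemma DD_comb (q : ℝ[X]) (p : ℝ → ℝ) (c : ℝ) {X : Finset ℝ} {d : ℕ} (hX : X.card = d + 1)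
    (hq : q.degree < d) : DD (fun t => q.eval t + c * p t) X = c * DD p X := by
  have := DD_poly hX hq
  simp only [DD] at *
  rw [Finset.mul_sum]
  simp only [add_div, Finset.sum_add_distrib, this, zero_add, mul_div_assoc]

lemma DD_pos {X : Finset ℝ} {d : ℕ} {p : ℝ → ℝ} {N M : ℝ} (hX : X.card = d + 1) (hM : M ∈ X)
    (hmax : ∀ x ∈ X, x ≤ M) (hdist : ∀ x ∈ X, ∀ y ∈ X, x ≠ y → 1 ≤ |x - y|)
    (hN : ∀ x ∈ X, ∀ y ∈ X, |x - y| ≤ N) (hpM : 0 < p M) (hd0 : 2 ≤ d) (hdN : (d : ℝ) ≤ N)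
    (hp : ∀ x ∈ X, x ≠ M → 0 ≤ p x ∧
      p x * N ^ (d - 1) ≤ (if x = M - 1 then (N - 1) / N else 1 / N ^ 2) * p M) :
    0 < DD p X := by
  have hd2 : (2:ℝ) ≤ d := by exact_mod_cast hd0
  have hNp : 0 < N := by linarith
  set A := p M / ∏ y ∈ X.erase M, (M - y) with hA
  have hlt : ∀ y ∈ X, y ≠ M → 0 < M - y := fun y hy hne =>
    sub_pos.2 (lt_of_le_of_ne (hmax y hy) hne)
  have hprod : 0 < ∏ y ∈ X.erase M, (M - y) :=
    Finset.prod_pos fun y hy => hlt y (mem_of_mem_erase hy) (ne_of_mem_erase hy)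
  have hApos : 0 < A := div_pos hpM hprod
  have hterm : ∀ x ∈ X.erase M, |p x / ∏ y ∈ X.erase x, (x - y)| ≤
      (if x = M - 1 then (N - 1) / N else 1 / N ^ 2) * A := by
    intro x hx
    have hxX := mem_of_mem_erase hx
    have hxM := ne_of_mem_erase hx
    obtain ⟨p0, p1⟩ := hp x hxX hxM
    set v : ℝ := (if x = M - 1 then (N - 1) / N else 1 / N ^ 2)
    have hg := hlt x hxX hxM
    have hMx : M ∈ X.erase x := mem_erase.2 ⟨hxM.symm, hM⟩
    have b1 : (M - x) ≤ |∏ y ∈ X.erase x, (x - y)| := by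
      rw [← Finset.mul_prod_erase _ _ hMx, abs_mul, abs_sub_comm, abs_of_pos hg, Finset.abs_prod]
      apply le_mul_of_one_le_right hg.le
      calc (1:ℝ) = ∏ y ∈ (X.erase x).erase M, 1 := by simp
        _ ≤ _ := Finset.prod_le_prod (by simp) fun y hy => by
          have h1 := mem_of_mem_erase hy
          exact hdist x hxX y (mem_of_mem_erase h1) (ne_of_mem_erase h1).symm
    have b2 : ∏ y ∈ X.erase M, (M - y) ≤ (M - x) * N ^ (d - 1) := by
      rw [← Finset.mul_prod_erase _ _ hx]
      apply mul_le_mul_of_nonneg_left _ hg.le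
      calc ∏ y ∈ (X.erase M).erase x, (M - y) ≤ ∏ y ∈ (X.erase M).erase x, N := by
            apply Finset.prod_le_prod
            · intro y hy
              have h1 := mem_of_mem_erase hy
              exact (hlt y (mem_of_mem_erase h1) (ne_of_mem_erase h1)).le
            · intro y hy
              have h1 := mem_of_mem_erase hy
              exact (le_abs_self _).trans (hN M hM y (mem_of_mem_erase h1))
        _ = N ^ (d - 1) := by
          rw [Finset.prod_const, card_erase_of_mem hx, card_erase_of_mem hM, hX]
          rfl
    have c1 : |p x / ∏ y ∈ X.erase x, (x - y)| ≤ p x / (M - x) := by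
      rw [abs_div, abs_of_nonneg p0]
      exact div_le_div_of_nonneg_left p0 hg b1
    have hNd : 0 < N ^ (d - 1) := by positivity
    have c2 : p M / ((M - x) * N ^ (d - 1)) ≤ A :=
      div_le_div_of_nonneg_left hpM.le hprod b2
    have hv : 0 ≤ v := by
      have : 0 ≤ v * p M := le_trans (by positivity) p1
      exact nonneg_of_mul_nonneg_left this hpM
    refine c1.trans (le_trans ?_ (mul_le_mul_of_nonneg_left c2 hv))
    rw [div_le_iff₀ hg]
    have : v * (p M / ((M - x) * N ^ (d - 1))) * (M - x) = v * p M / N ^ (d - 1) := by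
      field_simp
    rw [this, le_div_iff₀ hNd]
    exact p1
  have hsum : ∑ x ∈ X.erase M, (if x = M - 1 then (N - 1) / N else 1 / N ^ 2) < 1 := by
    have h1 : ∀ x ∈ X.erase M, (if x = M - 1 then (N - 1) / N else 1 / N ^ 2) =
        1 / N ^ 2 + (if x = M - 1 then (N - 1) / N - 1 / N ^ 2 else 0) := by
      intro x _
      split_ifs <;> ring
    rw [Finset.sum_congr rfl h1, Finset.sum_add_distrib, Finset.sum_const, card_erase_of_mem hM, hX,
      Finset.sum_ite_eq']
    have h2 : (if M - 1 ∈ X.erase M then (N - 1) / N - 1 / N ^ 2 else 0) ≤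
        max ((N - 1) / N - 1 / N ^ 2) 0 := by
      split_ifs
      · exact le_max_left _ _
      · exact le_max_right _ _
    have h4 : 0 ≤ (N - 1) / N - 1 / N ^ 2 := by
      have : (N - 1) / N - 1 / N ^ 2 = (N ^ 2 - N - 1) / N ^ 2 := by field_simp
      rw [this]
      apply div_nonneg _ (by positivity)
      nlinarith
    rw [max_eq_left h4] at h2
    have h5 : (d : ℝ) * (1 / N ^ 2) + ((N - 1) / N - 1 / N ^ 2) = (d + (N ^ 2 - N - 1)) / N ^ 2 := by
      field_simp
    have h6 : (d + (N ^ 2 - N - 1)) / N ^ 2 < 1 := by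
      rw [div_lt_one (by positivity)]
      linarith
    rw [Nat.add_sub_cancel, nsmul_eq_mul]
    linarith
  have hmain : DD p X = A + ∑ x ∈ X.erase M, p x / ∏ y ∈ X.erase x, (x - y) := by
    rw [DD, ← Finset.add_sum_erase _ _ hM]
  have habs : |∑ x ∈ X.erase M, p x / ∏ y ∈ X.erase x, (x - y)| < A := by
    calc _ ≤ ∑ x ∈ X.erase M, |p x / ∏ y ∈ X.erase x, (x - y)| := Finset.abs_sum_le_sum_abs _ _
      _ ≤ ∑ x ∈ X.erase M, (if x = M - 1 then (N - 1) / N else 1 / N ^ 2) * A := Finset.sum_le_sum hterm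
      _ = (∑ x ∈ X.erase M, (if x = M - 1 then (N - 1) / N else 1 / N ^ 2)) * A := by rw [Finset.sum_mul]
      _ < 1 * A := mul_lt_mul_of_pos_right hsum hApos
      _ = A := one_mul A
  rw [hmain]
  have := (abs_lt.1 habs).1
  linarith

end CurveSec

section CurveSec2
open Polynomial

lemma curve_of_aff {d n s : ℕ} (hd : 1 ≤ d) (ψ : (Fin d → ℝ) →ᵃ[ℝ] ℝ) :
    ∃ (q : ℝ[X]) (c : ℝ), q.degree < d ∧ (∀ t, ψ (acy d n s t) = q.eval t + c * acp d n s t) ∧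
      (q = 0 → c = 0 → ψ = 0) := by
  obtain ⟨b, c0, rfl⟩ := exists_affOf ψ
  obtain ⟨e, rfl⟩ : ∃ e, d = e + 1 := ⟨d - 1, by omega⟩
  refine ⟨C c0 - ∑ i : Fin e, C (b i.castSucc) * X ^ ((i : ℕ) + 1), - b (Fin.last e), ?_, ?_, ?_⟩
  · refine lt_of_le_of_lt (degree_sub_le _ _) (max_lt ?_ ?_)
    · refine lt_of_le_of_lt degree_C_le ?_
      exact_mod_cast Nat.succ_pos e
    · rw [← mem_degreeLT]
      refine Submodule.sum_mem _ fun i _ => ?_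
      rw [mem_degreeLT]
      refine lt_of_le_of_lt (degree_C_mul_X_pow_le _ _) ?_
      have := i.2
      exact_mod_cast (by omega : (i:ℕ) + 1 < e + 1)
  · intro t
    rw [affOf_apply, dotp, Fin.sum_univ_castSucc]
    have h1 : ∀ i : Fin e, acy (e+1) n s t i.castSucc = t ^ ((i:ℕ)+1) := by
      intro i
      have := i.2
      simp only [acy, Fin.val_castSucc]
      rw [if_neg (by omega)]
    have h2 : acy (e+1) n s t (Fin.last e) = acp (e+1) n s t := by simp [acy]
    simp only [h1, h2, eval_sub, eval_C, eval_finsetSum, eval_mul, eval_pow, eval_X]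
    ring
  · intro hq hc
    have hb : ∀ i : Fin e, b i.castSucc = 0 := by
      intro i
      have := congrArg (fun q => q.coeff ((i:ℕ)+1)) hq
      simp only [coeff_sub, coeff_C, finsetSum_coeff, coeff_C_mul, coeff_X_pow, coeff_zero] at this
      rw [Finset.sum_eq_single i] at this
      · simpa using this
      · intro j _ hj
        rw [if_neg, mul_zero]
        intro h
        exact hj (Fin.ext (by omega))
      · simp
    have hb' : b = 0 := by
      funext i
      refine Fin.lastCases ?_ ?_ i
      · simpa using hc
      · exact hb
    have hc0 : c0 = 0 := by
      have := congrArg (fun q => q.coeff 0) hq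
      simpa [hb'] using this
    subst hb' hc0
    refine AffineMap.ext fun x => ?_
    rw [affOf_apply]
    simp [dotp]

lemma aff_of_curve {d n s : ℕ} (hd : 1 ≤ d) (q : ℝ[X]) (c : ℝ) (hq : q.degree < d) :
    ∃ ψ : (Fin d → ℝ) →ᵃ[ℝ] ℝ, ∀ t, ψ (acy d n s t) = q.eval t + c * acp d n s t := by
  obtain ⟨e, rfl⟩ : ∃ e, d = e + 1 := ⟨d - 1, by omega⟩
  refine ⟨affOf (fun i => if (i:ℕ) = e then -c else - q.coeff ((i:ℕ)+1)) (q.coeff 0), fun t => ?_⟩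
  rw [affOf_apply, dotp, Fin.sum_univ_castSucc]
  have h1 : ∀ i : Fin e, acy (e+1) n s t i.castSucc = t ^ ((i:ℕ)+1) := by
    intro i
    have := i.2
    simp only [acy, Fin.val_castSucc]
    rw [if_neg (by omega)]
  have h2 : acy (e+1) n s t (Fin.last e) = acp (e+1) n s t := by simp [acy]
  have h3 : ∀ i : Fin e, (if ((i.castSucc : Fin (e+1)) : ℕ) = e then -c else - q.coeff (((i.castSucc : Fin (e+1)):ℕ)+1))
      = - q.coeff ((i:ℕ)+1) := by
    intro i
    have := i.2
    rw [if_neg (by simp; omega)]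
    simp
  have hdeg : q.natDegree < e + 1 := by
    by_cases h0 : q = 0
    · simp [h0]
    · exact (natDegree_lt_iff_degree_lt h0).2 hq
  rw [eval_eq_sum_range' hdeg, Finset.sum_range_succ', Finset.sum_range]
  simp only [h1, h2, h3]
  simp only [Fin.val_last, if_true, neg_mul, Finset.sum_neg_distrib]
  simp
  ring

end CurveSec2

section CurveSec3

def acTs (d n s : ℕ) : Finset ℝ := (range n).image (acT d s)

def acT0 (d n s : ℕ) : Finset ℝ := (acTs d n s).filter (· ≤ 0)

lemma mem_acTs {d n s : ℕ} {x : ℝ} : x ∈ acTs d n s ↔ ∃ k : ℕ, k < n ∧ x = (k:ℝ) + 1 - s - d := by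
  simp only [acTs, mem_image, mem_range, acT]
  constructor
  · rintro ⟨k, h, rfl⟩; exact ⟨k, h, rfl⟩
  · rintro ⟨k, h, rfl⟩; exact ⟨k, h, rfl⟩

lemma acT_inj {d s : ℕ} : Function.Injective (acT d s) := by
  intro a b h
  simp only [acT] at h
  have : (a:ℝ) = b := by linarith
  exact_mod_cast this

lemma card_acTs (d n s : ℕ) : (acTs d n s).card = n := by
  rw [acTs, card_image_of_injective _ acT_inj, card_range]

lemma acT0_eq {d n s : ℕ} (hn : d + s + 1 ≤ n) : acT0 d n s = (range (d+s)).image (acT d s) := by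
  ext x
  simp only [acT0, mem_filter, mem_acTs, mem_image, mem_range, acT]
  constructor
  · rintro ⟨⟨k, h, rfl⟩, h0⟩
    refine ⟨k, ?_, rfl⟩
    have : (k:ℝ) + 1 ≤ ((d + s : ℕ) : ℝ) := by push_cast; linarith
    have : k + 1 ≤ d + s := by exact_mod_cast this
    omega
  · rintro ⟨k, h, rfl⟩
    refine ⟨⟨k, by omega, rfl⟩, ?_⟩
    have : ((k + 1 : ℕ) : ℝ) ≤ ((d + s : ℕ) : ℝ) := by exact_mod_cast h
    push_cast at this
    linarith

lemma card_acT0 {d n s : ℕ} (hn : d + s + 1 ≤ n) : (acT0 d n s).card = d + s := by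
  rw [acT0_eq hn, card_image_of_injective _ acT_inj, card_range]

lemma acTs_dist {d n s : ℕ} {x y : ℝ} (hx : x ∈ acTs d n s) (hy : y ∈ acTs d n s) (hne : x ≠ y) :
    1 ≤ |x - y| := by
  obtain ⟨k, hk, rfl⟩ := mem_acTs.1 hx
  obtain ⟨l, hl, rfl⟩ := mem_acTs.1 hy
  have h : (k:ℝ) + 1 - s - d - ((l:ℝ) + 1 - s - d) = (((k:ℤ) - (l:ℤ) : ℤ) : ℝ) := by push_cast; ring
  rw [h]
  have h1 : (k:ℤ) - l ≠ 0 := by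
    intro h0
    apply hne
    have : (k:ℤ) = l := by omega
    have : k = l := by exact_mod_cast this
    rw [this]
  have := Int.one_le_abs h1
  exact_mod_cast this

lemma acTs_diam {d n s : ℕ} {x y : ℝ} (hx : x ∈ acTs d n s) (hy : y ∈ acTs d n s) :
    |x - y| ≤ (n:ℝ) - 1 := by
  obtain ⟨k, hk, rfl⟩ := mem_acTs.1 hx
  obtain ⟨l, hl, rfl⟩ := mem_acTs.1 hy
  have h1 : ((k + 1 : ℕ) : ℝ) ≤ n := by exact_mod_cast hk
  have h2 : ((l + 1 : ℕ) : ℝ) ≤ n := by exact_mod_cast hl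
  push_cast at h1 h2
  have h3 : (0:ℝ) ≤ k := by positivity
  have h4 : (0:ℝ) ≤ l := by positivity
  rw [abs_le]
  constructor <;> linarith

lemma acTs_le {d n s : ℕ} {x : ℝ} (hd : 1 ≤ d) (hx : x ∈ acTs d n s) : x ≤ (n:ℝ) - 1 := by
  obtain ⟨k, hk, rfl⟩ := mem_acTs.1 hx
  have h1 : ((k + 1 : ℕ) : ℝ) ≤ n := by exact_mod_cast hk
  have h2 : (1:ℝ) ≤ d := by exact_mod_cast hd
  have h3 : (0:ℝ) ≤ s := by positivity
  push_cast at h1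
  linarith

lemma acTs_pos {d n s : ℕ} {x : ℝ} (hx : x ∈ acTs d n s) (h : 0 < x) : 1 ≤ x := by
  obtain ⟨k, hk, rfl⟩ := mem_acTs.1 hx
  have : ((d + s : ℕ) : ℝ) < ((k + 1 : ℕ) : ℝ) := by push_cast; linarith
  have : d + s < k + 1 := by exact_mod_cast this
  have : ((d + s + 1 : ℕ) : ℝ) ≤ ((k + 1 : ℕ) : ℝ) := by exact_mod_cast this
  push_cast at this
  linarith

lemma acp_zero {d n s : ℕ} {x : ℝ} (hx : x ∈ acTs d n s) (h : x ≤ 0) : acp d n s x = 0 := by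
  obtain ⟨k, hk, rfl⟩ := mem_acTs.1 hx
  have : ((k + 1 : ℕ) : ℝ) ≤ ((d + s : ℕ) : ℝ) := by push_cast; linarith
  have : k + 1 ≤ d + s := by exact_mod_cast this
  rw [acp]
  apply mul_eq_zero_of_right
  apply Finset.prod_eq_zero (i := d + s - (k+1)) (mem_range.2 (by omega))
  rw [Nat.cast_sub this]
  push_cast
  ring

lemma acp_pos {d n s : ℕ} {x : ℝ} (hn : 2 ≤ n) (h : 0 < x) : 0 < acp d n s x := by
  have : (2:ℝ) ≤ n := by exact_mod_cast hn
  rw [acp]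
  apply mul_pos
  · apply Real.rpow_pos_of_pos; linarith
  · exact Finset.prod_pos fun l _ => by positivity

lemma acp_bound {d n s : ℕ} {x M : ℝ} (hd : 3 ≤ d) (hn : d + s + 1 ≤ n) (hx : x ∈ acTs d n s)
    (hM : M ∈ acTs d n s) (hM0 : 0 < M) (hxM : x < M) : 0 ≤ acp d n s x ∧
      acp d n s x * ((n:ℝ) - 1) ^ (d - 1) ≤
        (if x = M - 1 then ((n:ℝ) - 1 - 1) / ((n:ℝ) - 1) else 1 / ((n:ℝ)-1) ^ 2) * acp d n s M := by
  have hn4 : (4:ℝ) ≤ n := by exact_mod_cast (by omega : 4 ≤ n)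
  have hd3 : (3:ℝ) ≤ d := by exact_mod_cast hd
  set N := (n:ℝ) - 1 with hN
  have hN3 : 3 ≤ N := by linarith
  have hN0 : 0 < N := by linarith
  have hpM : 0 < acp d n s M := acp_pos (by omega) hM0
  rcases le_or_gt x 0 with h0 | h0
  · rw [acp_zero hx h0]
    refine ⟨le_rfl, ?_⟩
    rw [zero_mul]
    apply mul_nonneg _ hpM.le
    split_ifs
    · apply div_nonneg <;> linarith
    · positivity
  refine ⟨(acp_pos (by omega) h0).le, ?_⟩
  have e1 : acp d n s x * N ^ (d-1) = N ^ (x * ((d:ℝ)-1)) * ∏ l ∈ Finset.range (d + s), (x + l) := by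
    rw [acp, ← hN, ← Real.rpow_natCast, Nat.cast_sub (by omega), mul_right_comm, ← Real.rpow_add hN0]
    congr 2
    push_cast; ring
  rw [e1, acp, ← hN]
  have hx1 := acTs_pos hx h0
  split_ifs with hc
  · rw [← hc]
    have hMN : M ≤ N := acTs_le (by omega) hM
    have : ∏ l ∈ Finset.range (d + s), (x + l) ≤ (N-1)/N * ∏ l ∈ Finset.range (d + s), (M + l) := by
      obtain ⟨k, hk⟩ : ∃ k, d + s = k + 1 := ⟨d + s - 1, by omega⟩
      rw [hk, Finset.prod_range_succ', Finset.prod_range_succ', mul_comm, mul_comm _ (M + _), ← mul_assoc]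
      apply mul_le_mul
      · rw [div_mul_eq_mul_div, le_div_iff₀ hN0]
        push_cast
        nlinarith
      · apply Finset.prod_le_prod
        · intro i _; positivity
        · intro i _; linarith
      · exact Finset.prod_nonneg fun i _ => by positivity
      · apply mul_nonneg
        · apply div_nonneg <;> linarith
        · simp; linarith
    calc _ ≤ N ^ (x * ((d:ℝ)-1)) * ((N-1)/N * ∏ l ∈ Finset.range (d + s), (M + l)) :=
          mul_le_mul_of_nonneg_left this (Real.rpow_nonneg hN0.le _)
      _ = _ := by ring
  · have hx2 : x + 2 ≤ M := by
      have h1 : M - 1 ∈ acTs d n s ∨ M - 1 = x := by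
        left
        obtain ⟨k, hk, rfl⟩ := mem_acTs.1 hM
        obtain ⟨l, hl, rfl⟩ := mem_acTs.1 hx
        rcases Nat.eq_zero_or_pos k with rfl | hk0
        · exfalso
          have : (0:ℝ) ≤ l := by positivity
          push_cast at hxM
          linarith
        · refine mem_acTs.2 ⟨k - 1, by omega, ?_⟩
          rw [Nat.cast_sub hk0]; push_cast; ring
      rcases h1 with h1 | h1
      · have h2 := acTs_dist hx hM hxM.ne
        have h3 := acTs_dist hx h1 hc
        rw [abs_of_neg (by linarith)] at h2
        rw [abs_of_nonpos (by linarith)] at h3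
        linarith
      · exact absurd h1.symm hc
    have a1 : N ^ (x * ((d:ℝ)-1)) ≤ 1 / N^2 * N ^ ((M-1) * ((d:ℝ)-1)) := by
      have : 1 / N^2 * N ^ ((M-1) * ((d:ℝ)-1)) = N ^ ((M-1) * ((d:ℝ)-1) - 2) := by
        rw [Real.rpow_sub hN0]
        rw [show (2:ℝ) = ((2:ℕ):ℝ) by norm_num, Real.rpow_natCast]
        ring
      rw [this]
      apply Real.rpow_le_rpow_of_exponent_le (by linarith)
      nlinarith
    have a2 : ∏ l ∈ Finset.range (d + s), (x + l) ≤ ∏ l ∈ Finset.range (d + s), (M + l) := by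
      apply Finset.prod_le_prod
      · intro i _; positivity
      · intro i _; linarith
    calc _ ≤ (1 / N^2 * N ^ ((M-1) * ((d:ℝ)-1))) * ∏ l ∈ Finset.range (d + s), (M + l) := by
          apply mul_le_mul a1 a2
          · exact Finset.prod_nonneg fun i _ => by positivity
          · positivity
      _ = _ := by ring

lemma ac_DD_pos {d n s : ℕ} (hd : 3 ≤ d) (hn : d + s + 1 ≤ n) {X : Finset ℝ} (hX : X ⊆ acTs d n s)
    (hc : X.card = d + 1) (hpos : ∃ x ∈ X, 0 < x) : 0 < DD (acp d n s) X := by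
  obtain ⟨x0, hx0, hx0p⟩ := hpos
  have hne : X.Nonempty := ⟨x0, hx0⟩
  have hM := X.max'_mem hne
  have hM0 : 0 < X.max' hne := hx0p.trans_le (X.le_max' _ hx0)
  refine DD_pos (N := (n:ℝ) - 1) hc hM (fun x hx => X.le_max' _ hx)
    (fun x hx y hy h => acTs_dist (hX hx) (hX hy) h) (fun x hx y hy => acTs_diam (hX hx) (hX hy))
    (acp_pos (by omega) hM0) (by omega) ?_ ?_
  · have : ((d + 1 : ℕ) : ℝ) ≤ n := by exact_mod_cast (by omega : d + 1 ≤ n)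
    push_cast at this
    linarith
  · intro x hx hne'
    exact acp_bound hd hn (hX hx) (hX hM) hM0 (lt_of_le_of_ne (X.le_max' _ hx) hne')

open Polynomial in
lemma ac_L1 {d n s : ℕ} (hd : 3 ≤ d) (hn : d + s + 1 ≤ n) {X : Finset ℝ} (hX : X ⊆ acTs d n s)
    (hc : d + 1 ≤ X.card) (hpos : ∃ x ∈ X, 0 < x) (q : ℝ[X]) (c : ℝ) (hq : q.degree < d)
    (h : ∀ t ∈ X, q.eval t + c * acp d n s t = 0) : q = 0 ∧ c = 0 := by
  obtain ⟨x0, hx0, hx0p⟩ := hpos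
  obtain ⟨Y, hY1, hY2, hY3⟩ := Finset.exists_subsuperset_card_eq (s := {x0}) (t := X) (n := d+1)
    (by simpa using hx0) (by simp) hc
  have hD := ac_DD_pos hd hn (hY2.trans hX) hY3 ⟨x0, hY1 (by simp), hx0p⟩
  have h1 := DD_comb q (acp d n s) c hY3 hq
  have h2 : DD (fun t => q.eval t + c * acp d n s t) Y = 0 := by
    rw [DD]
    apply Finset.sum_eq_zero
    intro x hx
    rw [h x (hY2 hx), zero_div]
  rw [h2] at h1
  have hc0 : c = 0 := by
    rcases mul_eq_zero.1 h1.symm with h | h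
    · exact h
    · exact absurd h hD.ne'
  refine ⟨?_, hc0⟩
  apply Polynomial.eq_zero_of_degree_lt_of_eval_finset_eq_zero Y
  · rw [hY3]; refine hq.trans ?_; exact_mod_cast Nat.lt_succ_self d
  · intro x hx
    have := h x (hY2 hx)
    simpa [hc0] using this

lemma acy_inj {d n s : ℕ} (hd : 3 ≤ d) : Function.Injective (acy d n s) := by
  intro a b h
  have := congrFun h ⟨0, by omega⟩
  simp only [acy] at this
  rw [if_neg (by omega), if_neg (by omega)] at this
  simpa using this

end CurveSec3

section CurveSec4
open Polynomial

variable {d n s : ℕ}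

def acV (d n s : ℕ) : Finset (Fin d → ℝ) := (acTs d n s).image (acy d n s)
def acF (d n s : ℕ) : Finset (Fin d → ℝ) := (acT0 d n s).image (acy d n s)

lemma ac_pull {G : Finset (Fin d → ℝ)} (hG : G ⊆ acV d n s) :
    ∃ X ⊆ acTs d n s, G = X.image (acy d n s) := by
  refine ⟨(acTs d n s).filter (fun t => acy d n s t ∈ G), filter_subset _ _, ?_⟩
  ext v
  simp only [mem_image, mem_filter]
  constructor
  · intro hv
    obtain ⟨t, ht, rfl⟩ := mem_image.1 (hG hv)
    exact ⟨t, ⟨ht, hv⟩, rfl⟩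
  · rintro ⟨t, ⟨_, h⟩, rfl⟩
    exact h

lemma acy_mem (hd : 3 ≤ d) {X : Finset ℝ} {t : ℝ} : acy d n s t ∈ X.image (acy d n s) ↔ t ∈ X := by
  rw [mem_image]
  exact ⟨fun ⟨a, ha, h⟩ => acy_inj hd h ▸ ha, fun h => ⟨t, h, rfl⟩⟩

lemma acy_card (hd : 3 ≤ d) {X : Finset ℝ} : (X.image (acy d n s)).card = X.card :=
  card_image_of_injective _ (acy_inj hd)

lemma ac_sup (hd : 3 ≤ d) {W : Finset ℝ} (hW : W ⊆ acTs d n s) (hne : W ≠ acTs d n s) (q : ℝ[X]) (c : ℝ)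
    (hq : q.degree < d) (h : ∀ t ∈ acTs d n s, 0 ≤ q.eval t + c * acp d n s t ∧
      (q.eval t + c * acp d n s t = 0 ↔ t ∈ W)) : Sup (acV d n s) (W.image (acy d n s)) := by
  obtain ⟨ψ, hψ⟩ := aff_of_curve (n := n) (s := s) (by omega) q c hq
  refine ⟨image_subset_image hW, ?_, ψ, ?_⟩
  · intro h
    exact hne ((image_injective (acy_inj hd)) h)
  · intro v hv
    obtain ⟨t, ht, rfl⟩ := mem_image.1 hv
    rw [hψ, acy_mem hd]
    exact h t ht

lemma ac_exists_pos (hn : d + s + 1 ≤ n) : ∃ x ∈ acTs d n s, 0 < x := by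
  refine ⟨1, mem_acTs.2 ⟨d + s, by omega, ?_⟩, one_pos⟩
  push_cast; ring

lemma ac_small (hd : 3 ≤ d) (hn : d + s + 1 ≤ n) {S : Finset ℝ} (hS : S ⊆ acTs d n s)
    (hc : 2 * S.card < d) : Sup (acV d n s) (S.image (acy d n s)) := by
  refine ac_sup hd hS ?_ ((∏ x ∈ S, (X - C x)) ^ 2) 0 ?_ ?_
  · rintro rfl
    rw [card_acTs] at hc
    omega
  · rw [degree_pow, degree_prod]
    simp only [degree_X_sub_C, sum_const]
    rw [smul_smul]
    simp only [nsmul_eq_mul, mul_one]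
    exact_mod_cast hc
  · intro t ht
    simp only [eval_pow, eval_prod, eval_sub, eval_X, eval_C, zero_mul, add_zero]
    refine ⟨sq_nonneg _, ?_⟩
    rw [sq_eq_zero_iff, Finset.prod_eq_zero_iff]
    constructor
    · rintro ⟨a, ha, h⟩
      rwa [sub_eq_zero.1 h]
    · intro h
      exact ⟨t, h, sub_self t⟩

lemma ac_aspd (hd : 3 ≤ d) (hn : d + s + 1 ≤ n) : ASPd (acV d n s) (acF d n s) := by
  have hpos := ac_exists_pos hn
  have span : ∀ ψ : (Fin d → ℝ) →ᵃ[ℝ] ℝ, (∀ v ∈ acV d n s, ψ v = 0) → ψ = 0 := by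
    intro ψ h
    obtain ⟨q, c, hq, hψ, h0⟩ := curve_of_aff (n := n) (s := s) (by omega) ψ
    have := ac_L1 hd hn (X := acTs d n s) Subset.rfl (by rw [card_acTs]; omega) hpos q c hq
      (fun t ht => by rw [← hψ]; exact h _ (mem_image_of_mem _ ht))
    exact h0 this.1 this.2
  have hT0 : acT0 d n s ⊆ acTs d n s := filter_subset _ _
  refine ⟨?_, span, ⟨?_, ?_⟩, ?_⟩
  · apply Set.Subset.antisymm extremePoints_convexHull_subset
    intro v hv
    obtain ⟨t, ht, rfl⟩ := mem_image.1 (Finset.mem_coe.1 hv)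
    obtain ⟨h1, h2, φ, hφ⟩ := ac_small hd hn (S := {t}) (by simpa using ht) (by simp; omega)
    have hf := sup_face h1 hφ
    rw [image_singleton, coe_singleton, convexHull_singleton] at hf
    have hnn := conv_nonneg fun v hv => (hφ v hv).1
    refine mem_extremePoints_iff_left.2 ?_
    refine ⟨subset_convexHull ℝ _ hv, ?_⟩
    rintro x hx y hy ⟨a, b, ha, hb, hab, he⟩
    have hx0 := hnn x hx
    have hy0 := hnn y hy
    have hc := aff_comb φ x y hab
    have hz : φ (acy d n s t) = 0 := (hφ _ hv).2.2 (by simp)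
    rw [he, hz] at hc
    have : φ x = 0 := by
      have h3 : 0 ≤ b * φ y := by positivity
      have h4 : 0 ≤ a * φ x := by positivity
      have h5 : a * φ x = 0 := by linarith
      rcases mul_eq_zero.1 h5 with h | h
      · exact absurd h ha.ne'
      · exact h
    have hm : x ∈ {x ∈ convexHull ℝ (acV d n s : Set (Fin d → ℝ)) | φ x = 0} := ⟨hx, this⟩
    rw [hf] at hm
    exact hm
  · refine ac_sup hd hT0 ?_ 0 1 (by simp) ?_
    · intro h
      obtain ⟨x, hx, hx0⟩ := hpos
      rw [← h] at hx
      have := (mem_filter.1 hx).2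
      linarith
    · intro t ht
      simp only [eval_zero, zero_add, one_mul]
      rcases le_or_gt t 0 with h0 | h0
      · rw [acp_zero ht h0]
        simp [acT0, ht, h0]
      · have := acp_pos (d := d) (s := s) (n := n) (by omega) h0
        refine ⟨this.le, ?_⟩
        simp [acT0, this.ne', h0]
  · intro ψ h w hw hwF hψw
    obtain ⟨q, c, hq, hψ, h0⟩ := curve_of_aff (n := n) (s := s) (by omega) ψ
    obtain ⟨t, ht, rfl⟩ := mem_image.1 hw
    rw [acF, acy_mem hd] at hwF
    have := ac_L1 hd hn (X := insert t (acT0 d n s)) (insert_subset ht hT0)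
      (by rw [card_insert_of_notMem hwF, card_acT0 hn]; omega)
      ⟨t, mem_insert_self _ _, by
        by_contra hc
        exact hwF (mem_filter.2 ⟨ht, not_lt.1 hc⟩)⟩ q c hq
      (fun x hx => by
        rw [← hψ]
        rcases mem_insert.1 hx with rfl | hx
        · exact hψw
        · exact h _ (mem_image_of_mem _ hx))
    rw [h0 this.1 this.2]
    simp
  · intro G hG hne
    have hc := fct_card' span (by omega) hG
    by_contra hcne
    obtain ⟨X, hX, rfl⟩ := ac_pull hG.1.1
    rw [acy_card hd] at hc hcne
    obtain ⟨h1, h2, φ, hφ⟩ := hG.1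
    obtain ⟨q, c, hq, hψ, h0⟩ := curve_of_aff (n := n) (s := s) (by omega) φ
    have hz : ∀ t ∈ X, q.eval t + c * acp d n s t = 0 := fun t ht => by
      rw [← hψ]
      exact (hφ _ (mem_image_of_mem _ (hX ht))).2.2 (mem_image_of_mem _ ht)
    by_cases hp : ∃ x ∈ X, 0 < x
    · have := ac_L1 hd hn hX (by omega) hp q c hq hz
      have hφ0 := h0 this.1 this.2
      obtain ⟨w, hw, hw'⟩ := hG.1.exists_out
      exact hw' ((hφ w hw).2.1 (by rw [hφ0]; simp))
    · push Not at hp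
      have hq0 : q = 0 := by
        apply Polynomial.eq_zero_of_degree_lt_of_eval_finset_eq_zero X
        · refine hq.trans_le ?_
          exact_mod_cast hc
        · intro x hx
          have := hz x hx
          rw [acp_zero (hX hx) (hp x hx)] at this
          simpa using this
      apply hne
      rw [acF]
      congr 1
      ext t
      constructor
      · intro ht
        exact mem_filter.2 ⟨hX ht, hp t ht⟩
      · intro ht
        have htT := hT0 ht
        have : φ (acy d n s t) = 0 := by
          rw [hψ, hq0, acp_zero htT (mem_filter.1 ht).2]
          simp
        exact (acy_mem hd).1 ((hφ _ (mem_image_of_mem _ htT)).2.1 this)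

lemma W_lemma (k : ℕ) : ∀ S T : Finset ℝ, S.card = k → S ⊆ T → 2 * k ≤ T.card →
    ∃ W, S ⊆ W ∧ W ⊆ T ∧ W.card = 2 * k ∧ ∀ t ∈ T, t ∉ W → 0 < ∏ w ∈ W, (t - w) := by
  induction k with
  | zero =>
    intro S T hS _ _
    rw [card_eq_zero] at hS
    subst hS
    exact ⟨∅, by simp⟩
  | succ k ih =>
    intro S T hS hST hT
    have hne : (S ×ˢ (T \ S)).Nonempty := by
      rw [← card_pos, card_product, card_sdiff_of_subset hST, hS]
      apply Nat.mul_pos <;> omega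
    obtain ⟨⟨r, r'⟩, hr, hmin⟩ := exists_min_image (S ×ˢ (T \ S)) (fun z => |z.1 - z.2|) hne
    simp only [mem_product, mem_sdiff] at hr hmin
    obtain ⟨hrS, hrT', hrS'⟩ := hr
    have hrr : r ≠ r' := fun h => hrS' (h ▸ hrS)
    obtain ⟨W, h1, h2, h3, h4⟩ := ih (S.erase r) ((T.erase r).erase r')
      (by rw [card_erase_of_mem hrS, hS]; rfl)
      (by
        intro x hx
        have hx' := mem_erase.1 hx
        exact mem_erase.2 ⟨fun h => hrS' (h ▸ hx'.2), mem_erase.2 ⟨hx'.1, hST hx'.2⟩⟩)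
      (by
        rw [card_erase_of_mem (mem_erase.2 ⟨hrr.symm, hrT'⟩), card_erase_of_mem (hST hrS)]
        omega)
    have n1 : r' ∉ W := fun h => by simpa using h2 h
    have n2 : r ∉ insert r' W := fun h => by
      rcases mem_insert.1 h with h | h
      · exact hrr h
      · simpa using h2 h
    refine ⟨insert r (insert r' W), ?_, ?_, ?_, ?_⟩
    · intro x hx
      by_cases hxr : x = r
      · simp [hxr]
      · exact mem_insert_of_mem (mem_insert_of_mem (h1 (mem_erase.2 ⟨hxr, hx⟩)))
    · refine insert_subset (hST hrS) (insert_subset hrT' fun x hx => ?_)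
      exact mem_of_mem_erase (mem_of_mem_erase (h2 hx))
    · rw [card_insert_of_notMem n2, card_insert_of_notMem n1, h3]
      ring
    · intro t ht htW
      simp only [mem_insert, not_or] at htW
      obtain ⟨a1, a2, a3⟩ := htW
      rw [prod_insert n2, prod_insert n1, ← mul_assoc]
      apply mul_pos
      · have htS : t ∉ S := fun h => a3 (h1 (mem_erase.2 ⟨a1, h⟩))
        have := hmin (r, t) ⟨hrS, ht, htS⟩
        simp only at this
        rcases lt_or_gt_of_ne a1 with b1 | b1 <;> rcases lt_or_gt_of_ne a2 with b2 | b2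
        · exact mul_pos_of_neg_of_neg (by linarith) (by linarith)
        · rw [abs_of_pos (by linarith), abs_of_pos (by linarith)] at this
          linarith
        · rw [abs_of_neg (by linarith), abs_of_neg (by linarith)] at this
          linarith
        · exact mul_pos (by linarith) (by linarith)
      · exact h4 t (mem_erase.2 ⟨a2, mem_erase.2 ⟨a1, ht⟩⟩) a3

lemma ac_big (hd : 3 ≤ d) (hn : d + s + 1 ≤ n) {S : Finset ℝ} (hS : S ⊆ acTs d n s)
    (hc : 2 * S.card = d) (hp : ∃ x ∈ S, 0 < x) :
    ∃ W, S ⊆ W ∧ Sup (acV d n s) (W.image (acy d n s)) := by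
  obtain ⟨W, h1, h2, h3, h4⟩ := W_lemma S.card S (acTs d n s) rfl hS (by rw [card_acTs]; omega)
  rw [hc] at h3
  refine ⟨W, h1, ?_⟩
  have hinj : Set.InjOn (fun x : ℝ => x) (W : Set ℝ) := fun _ _ _ _ h => h
  set L := Lagrange.interpolate W (fun x => x) (acp d n s) with hL
  have hLd : L.degree < d := by
    have := Lagrange.degree_interpolate_lt (s := W) (v := fun x : ℝ => x) (acp d n s) hinj
    rwa [h3] at this
  have hLe : ∀ x ∈ W, L.eval x = acp d n s x := fun x hx =>
    Lagrange.eval_interpolate_at_node (s := W) (v := fun x : ℝ => x) (acp d n s) hinj hx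
  have hz : ∀ x ∈ W, (-L).eval x + 1 * acp d n s x = 0 := fun x hx => by
    rw [eval_neg, hLe x hx]; ring
  refine ac_sup hd h2 ?_ (-L) 1 (by rwa [degree_neg]) ?_
  · rintro rfl
    rw [card_acTs] at h3
    omega
  · intro t ht
    by_cases htW : t ∈ W
    · rw [hz t htW]
      simp [htW]
    · have hcard : (insert t W).card = d + 1 := by rw [card_insert_of_notMem htW, h3]
      have hD := ac_DD_pos hd hn (X := insert t W) (insert_subset ht h2) hcard (by
        obtain ⟨x, hx, hx0⟩ := hp
        exact ⟨x, mem_insert_of_mem (h1 hx), hx0⟩)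
      have hcomb := DD_comb (-L) (acp d n s) 1 hcard (by rwa [degree_neg])
      have hval : DD (fun t => (-L).eval t + 1 * acp d n s t) (insert t W) =
          ((-L).eval t + 1 * acp d n s t) / ∏ w ∈ W, (t - w) := by
        rw [DD, sum_insert htW, erase_insert htW, Finset.sum_eq_zero, add_zero]
        intro x hx
        rw [hz x hx, zero_div]
      rw [hval, one_mul (DD _ _)] at hcomb
      have hP := h4 t ht htW
      have : 0 < (-L).eval t + 1 * acp d n s t := by
        rw [← hcomb] at hD
        by_contra hcon
        have := div_nonpos_of_nonpos_of_nonneg (not_lt.1 hcon) hP.le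
        linarith
      exact ⟨this.le, by simp only [htW, iff_false]; exact this.ne'⟩

lemma ac_cover1 (hd : 3 ≤ d) (hn : d + s + 1 ≤ n) {S : Finset (Fin d → ℝ)} (hS : S ⊆ acV d n s)
    (hc : S.card ≤ (d-1)/2) : ∃ G ∈ fam (acV d n s) (acF d n s), S ⊆ G := by
  obtain ⟨X, hX, rfl⟩ := ac_pull hS
  rw [acy_card hd] at hc
  apply (ac_aspd hd hn).cover (ac_small hd hn hX (by omega))
  intro h
  have := congrArg Finset.card h
  rw [acF, acy_card hd, acy_card hd, card_acT0 hn] at this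
  omega

lemma ac_cover2 (hd : 3 ≤ d) (hn : d + s + 1 ≤ n) {S : Finset (Fin d → ℝ)} (hS : S ⊆ acV d n s)
    (hc : S.card ≤ d/2) (hF : ¬ S ⊆ acF d n s) : ∃ G ∈ fam (acV d n s) (acF d n s), S ⊆ G := by
  by_cases h : S.card ≤ (d-1)/2
  · exact ac_cover1 hd hn hS h
  obtain ⟨X, hX, rfl⟩ := ac_pull hS
  rw [acy_card hd] at hc h
  have hp : ∃ x ∈ X, 0 < x := by
    by_contra hcon
    push Not at hcon
    exact hF (image_subset_image fun x hx => mem_filter.2 ⟨hX hx, hcon x hx⟩)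
  obtain ⟨W, hW, hsup⟩ := ac_big hd hn hX (by omega) hp
  obtain ⟨G, hG, hWG⟩ := (ac_aspd hd hn).cover hsup (by
    rintro h
    exact hF (h ▸ image_subset_image hW))
  exact ⟨G, hG, (image_subset_image hW).trans hWG⟩

lemma ac_main (d n s : ℕ) (hd : 3 ≤ d) (hn : d + s + 1 ≤ n) :
    ∃ V F : Finset (Fin d → ℝ), acPolytope d n s = convexHull ℝ (V : Set (Fin d → ℝ)) ∧
      V.card = n ∧ F.card = d + s ∧ ASPd V F ∧
      (∀ j ≤ (d-1)/2, (faces (fam V F) j).card = V.card.choose j) ∧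
      (∀ j ≤ d/2, ((faces (fam V F) j).filter (fun S => ¬ S ⊆ F)).card + (d+s).choose j = V.card.choose j) := by
  have hsub : ∀ G ∈ fam (acV d n s) (acF d n s), G ⊆ acV d n s := fun G hG => (mem_fam.1 hG).1.1.1
  have hFc : (acF d n s).card = d + s := by rw [acF, acy_card hd, card_acT0 hn]
  have hFV : acF d n s ⊆ acV d n s := image_subset_image (filter_subset _ _)
  refine ⟨acV d n s, acF d n s, ?_, ?_, hFc, ac_aspd hd hn, ?_, ?_⟩
  · rw [acPolytope]
    congr 1
    ext v
    simp only [Set.mem_range, acPoint, acV, acTs, coe_image, Set.mem_image, coe_range, Set.mem_Iio]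
    constructor
    · rintro ⟨j, rfl⟩
      exact ⟨_, ⟨j, j.2, rfl⟩, rfl⟩
    · rintro ⟨_, ⟨j, hj, rfl⟩, rfl⟩
      exact ⟨⟨j, hj⟩, rfl⟩
  · rw [acV, acy_card hd, card_acTs]
  · intro j hj
    rw [← card_powersetCard]
    congr 1
    ext S
    rw [mem_faces, mem_powersetCard]
    constructor
    · rintro ⟨⟨G, hG, hSG⟩, hc⟩
      exact ⟨hSG.trans (hsub G hG), hc⟩
    · rintro ⟨hSV, hc⟩
      exact ⟨ac_cover1 hd hn hSV (by omega), hc⟩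
  · intro j hj
    rw [← card_powersetCard j (acV d n s), ← hFc, ← card_powersetCard j (acF d n s),
      ← card_union_of_disjoint]
    · congr 1
      ext S
      rw [mem_union, mem_filter, mem_faces, mem_powersetCard, mem_powersetCard]
      constructor
      · rintro (⟨⟨⟨G, hG, hSG⟩, hc⟩, _⟩ | ⟨hSF, hc⟩)
        · exact ⟨hSG.trans (hsub G hG), hc⟩
        · exact ⟨hSF.trans hFV, hc⟩
      · rintro ⟨hSV, hc⟩
        by_cases hSF : S ⊆ acF d n s
        · exact Or.inr ⟨hSF, hc⟩
        · exact Or.inl ⟨⟨ac_cover2 hd hn hSV (by omega) hSF, hc⟩, hSF⟩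
    · rw [Finset.disjoint_left]
      intro S h1 h2
      exact (mem_filter.1 h1).2 (mem_powersetCard.1 h2).1

end CurveSec4

theorem ubt_asp_equality_case (d n s : ℕ)
    (P : Set (Fin d → ℝ)) (hP : MemASP d n s P)
    (hEq : ∃ i : ℕ, (d - 1) / 2 ≤ i ∧ i ≤ d ∧
      fVec P (i - 1) = fVec (acPolytope d n s) (i - 1)) :
    IsNeighborly ((d - 1) / 2) P := by
  by_cases hd3 : 3 ≤ d
  swap
  · intro S _ hc
    have : S = ∅ := by rw [← card_eq_zero]; omega
    subst this
    exact ⟨∅, Or.inl rfl, by simp [verts]⟩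
  have hd : 0 < d := by omega
  obtain ⟨hn, F0, hASP, hF0⟩ := hP
  obtain ⟨V, F, rfl, hV, hF, A⟩ := exists_ASPd hd hASP
  rw [hV, Set.ncard_coe_finset] at hn
  rw [hF, Set.ncard_coe_finset] at hF0
  have hlt : F.card < V.card := card_lt_card (lt_of_le_of_ne A.fct.1.1 A.fct.1.2.1)
  obtain ⟨V', F', hC, hV', hF', A', h1, h2⟩ := ac_main d n s hd3 (by omega)
  obtain ⟨i, hi1, hi2, he⟩ := hEq
  have hi0 : 1 ≤ i := by omega
  have heq : (faces (fam V F) i).card = (faces (fam V' F') i).card := by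
    rw [hC] at he
    rcases hi2.lt_or_eq with hi | rfl
    · rwa [A.fVec_lt hi0 hi, A'.fVec_lt hi0 hi] at he
    · rw [A.fVec_d hd, A'.fVec_d hd] at he
      omega
  have hcmp := Core.compare (A.core hd hF0) (A'.core hd hF') (by omega) hd3 h1 h2 hi1 hi2 heq
  intro S hS hc
  rw [hV] at hS
  have hS : S ⊆ V := by exact_mod_cast hS
  obtain ⟨S', hSS', hS'V, hc'⟩ := Finset.exists_subsuperset_card_eq hS hc (by omega)
  have hsub : faces (fam V F) ((d - 1) / 2) ⊆ V.powersetCard ((d - 1) / 2) := by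
    intro T hT
    obtain ⟨⟨G, hG, hs⟩, hc⟩ := mem_faces.1 hT
    exact mem_powersetCard.2 ⟨hs.trans (mem_fam.1 hG).1.1.1, hc⟩
  have hall := Finset.eq_of_subset_of_card_le hsub (by rw [hcmp, card_powersetCard])
  have hS'f : S' ∈ faces (fam V F) ((d - 1) / 2) := by
    rw [hall]; exact mem_powersetCard.2 ⟨hS'V, hc'⟩
  obtain ⟨⟨G, hG, hs⟩, -⟩ := mem_faces.1 hS'f
  exact ⟨_, (A.sub_sup hd hG (hSS'.trans hs)).face, verts_sub hV hS⟩

end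

end ASP
end

section
/- (Simpliciality of polytopes on a generalized moment curve.) Let d > r ≥ 0, let p_1, …, p_r : R → R be arbitrary functions, and let x(t) = (t, t², …, t^{d−r}, p_1(t), …, p_r(t)) ∈ R^d. For any n distinct real numbers t_1, …, t_n, the polytope Q = conv{x(t_1), …, x(t_n)} is (d−r−1)-simplicial: every face of Q of dimension at most d−r−1 is a simplex (i.e. its vertex set is affinely independent). -/
open Finset

namespace ASP

noncomputable section

theorem gmc_affineIndependent (d r : ℕ) (p : Fin r → ℝ → ℝ) {m : ℕ} (hm : m ≤ d - r + 1)
    (s : Fin m → ℝ) (hs : Function.Injective s) :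
    AffineIndependent ℝ (fun j => gmc d r p (s j)) := by
  rw [affineIndependent_iff_of_fintype]
  intro w hw h0
  rw [Finset.weightedVSub_eq_linear_combination _ hw] at h0
  have key : w = 0 := by
    apply Matrix.eq_zero_of_forall_pow_sum_mul_pow_eq_zero hs
    intro k
    rcases k with ⟨k, hk⟩
    rcases k with _ | k
    · simpa using hw
    · have h1 := congrFun h0 ⟨k, by omega⟩
      have h2 : k < d - r := by omega
      simpa [gmc, Finset.sum_apply, h2] using h1
  intro i
  rw [key]; rfl

theorem gmc_affineIndependent_finset (d r n : ℕ) (p : Fin r → ℝ → ℝ)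
    (t : Fin n → ℝ) (ht : Function.Injective t) (J : Finset (Fin n)) (hJ : J.card ≤ d - r + 1) :
    AffineIndependent ℝ (fun j : J => gmc d r p (t j)) := by
  have h := gmc_affineIndependent d r p hJ (fun i => t (J.equivFin.symm i))
    (fun a b hab => by simpa using ht hab)
  have h' := h.comp_embedding J.equivFin.toEmbedding
  convert h' using 2
  simp

theorem face_isExtreme {d : ℕ} {P G : Set (Fin d → ℝ)} (h : IsFaceOf P G) :
    IsExtreme ℝ P G := by
  rcases h with rfl | rfl | ⟨b, c, -, hb, rfl⟩
  · exact ⟨Set.empty_subset _, fun _ _ _ _ _ hz => hz.elim⟩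
  · exact IsExtreme.rfl
  · refine ⟨Set.sep_subset _ _, ?_⟩
    rintro x hx y hy z ⟨hz, hzc⟩ ⟨a, a', ha, ha', haa, rfl⟩
    refine ⟨hx, ?_⟩
    have e : dotp b (a • x + a' • y) = a * dotp b x + a' * dotp b y := by
      simp only [dotp, Finset.mul_sum, ← Finset.sum_add_distrib, Pi.add_apply, Pi.smul_apply,
        smul_eq_mul]
      exact Finset.sum_congr rfl fun i _ => by ring
    rw [e] at hzc
    have h1 := hb x hx
    have h2 := hb y hy
    have h3 : a' * dotp b y ≤ a' * c := by gcongr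
    have h4 : a * c ≤ a * dotp b x := by
      have : a * c + a' * c = c := by rw [← add_mul, haa, one_mul]
      linarith
    exact le_antisymm h1 (le_of_mul_le_mul_left h4 ha)

/-- **Simpliciality of polytopes on a generalized moment curve.** For `d > r ≥ 0`,
arbitrary `p_1, …, p_r : ℝ → ℝ` and `n` distinct reals `t_1, …, t_n`, the polytope
`Q = conv{x(t_1), …, x(t_n)}` is `(d−r−1)`-simplicial: every face of `Q` of dimension
at most `d − r − 1` has affinely independent vertex set. -/
theorem gmc_simplicial (d r n : ℕ) (hr : r < d) (p : Fin r → ℝ → ℝ)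
    (t : Fin n → ℝ) (ht : Function.Injective t) :
    ∀ G : Set (Fin d → ℝ),
      IsFaceOf (convexHull ℝ (Set.range fun j : Fin n => gmc d r p (t j))) G →
      polyDim G ≤ d - r - 1 →
      AffineIndependent ℝ (fun v : verts G => (v : Fin d → ℝ)) := by
  intro G hG hdim
  classical
  have hV : verts G ⊆ Set.range fun j : Fin n => gmc d r p (t j) :=
    (face_isExtreme hG).extremePoints_subset_extremePoints.trans extremePoints_convexHull_subset
  let J : Finset (Fin n) := Finset.univ.filter fun j => gmc d r p (t j) ∈ verts G
  by_cases hJ : J.card ≤ d - r + 1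
  · have h := (gmc_affineIndependent_finset d r n p t ht J hJ).range
    refine h.mono ?_
    intro v hv
    obtain ⟨j, rfl⟩ := hV hv
    exact ⟨⟨j, by simpa [J] using hv⟩, rfl⟩
  · exfalso
    obtain ⟨K, hKJ, hK⟩ := Finset.exists_subset_card_eq (s := J) (n := d - r + 1) (by omega)
    have h := gmc_affineIndependent_finset d r n p t ht K hK.le
    have hf := h.finrank_vectorSpan (n := d - r) (by simpa using hK)
    have hsub : Set.range (fun j : K => gmc d r p (t j)) ⊆ G := by
      rintro _ ⟨⟨j, hj⟩, rfl⟩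
      have := hKJ hj
      simp only [J, Finset.mem_filter] at this
      exact this.2.1
    have hle := Submodule.finrank_mono (vectorSpan_mono ℝ hsub)
    rw [polyDim, direction_affineSpan] at hdim
    omega

end

end ASP
end

section
/- (Neighborliness of polytopes on a generalized moment curve.) Let d > r ≥ 0, let p_1, …, p_r : R → R be arbitrary functions, and let x(t) = (t, t², …, t^{d−r}, p_1(t), …, p_r(t)) ∈ R^d. For any n distinct real numbers t_1, …, t_n, the polytope Q = conv{x(t_1), …, x(t_n)} is ⌊(d−r)/2⌋-neighborly: for every subset S ⊆ {t_1, …, t_n} with |S| ≤ ⌊(d−r)/2⌋, the set {x(t) : t ∈ S} is the vertex set of a face of Q; in particular there exist b ∈ R^d and c ∈ R with ⟨x(t), b⟩ = c for all t ∈ S and ⟨x(t_l), b⟩ > c for all t_l ∉ S. -/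
open Finset

namespace ASP

noncomputable section

lemma gmc_sep (d r n : ℕ) (hr : r < d) (p : Fin r → ℝ → ℝ)
    (t : Fin n → ℝ) (ht : Function.Injective t) (S : Finset (Fin n))
    (hS : S.card ≤ (d - r) / 2) :
    ∃ (b : Fin d → ℝ) (c : ℝ), (S.Nonempty → b ≠ 0) ∧
        (∀ j ∈ S, dotp (gmc d r p (t j)) b = c) ∧
        (∀ j : Fin n, j ∉ S → c < dotp (gmc d r p (t j)) b) := by
  classical
  set f : Polynomial ℝ := (∏ j ∈ S, (Polynomial.X - Polynomial.C (t j))) ^ 2 with hf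
  have hmon0 : (∏ j ∈ S, (Polynomial.X - Polynomial.C (t j))).Monic :=
    Polynomial.monic_prod_of_monic _ _ fun j _ => Polynomial.monic_X_sub_C _
  have hmon : f.Monic := hmon0.pow 2
  have hdeg : f.natDegree = 2 * S.card := by
    rw [hf, Polynomial.natDegree_pow, Polynomial.natDegree_prod_of_monic _ _
      fun j _ => Polynomial.monic_X_sub_C _]
    simp
  have heval : ∀ x : ℝ, f.eval x = (∏ j ∈ S, (x - t j)) ^ 2 := by
    intro x
    simp [hf, Polynomial.eval_prod]
  have hdot : ∀ x : ℝ, dotp (gmc d r p x) (fun i : Fin d => f.coeff ((i : ℕ) + 1))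
      = f.eval x - f.coeff 0 := by
    intro x
    rw [Polynomial.eval_eq_sum_range' (n := d + 1) (by omega), Finset.sum_range_succ']
    simp only [pow_zero, mul_one, add_sub_cancel_right]
    rw [← Fin.sum_univ_eq_sum_range (fun i => f.coeff (i + 1) * x ^ (i + 1)) d]
    unfold dotp
    refine Finset.sum_congr rfl fun i _ => ?_
    unfold gmc
    split_ifs with h
    · ring
    · have h0 : f.coeff ((i : ℕ) + 1) = 0 :=
        Polynomial.coeff_eq_zero_of_natDegree_lt (by omega)
      simp [h0]
  refine ⟨fun i => f.coeff ((i : ℕ) + 1), - f.coeff 0, ?_, ?_, ?_⟩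
  · intro hne h0
    have hpos := hne.card_pos
    have h1 := congrFun h0 ⟨2 * S.card - 1, by omega⟩
    have h2 : 2 * S.card - 1 + 1 = f.natDegree := by omega
    simp only [h2, Pi.zero_apply, hmon.coeff_natDegree] at h1
    exact one_ne_zero h1
  · intro j hj
    rw [hdot, heval, Finset.prod_eq_zero hj (sub_self _)]
    simp
  · intro j hj
    rw [hdot, heval]
    have : (∏ k ∈ S, (t j - t k)) ≠ 0 := by
      rw [Finset.prod_ne_zero_iff]
      intro k hk h
      have : j = k := ht (sub_eq_zero.1 h)
      exact hj (this ▸ hk)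
    have := pow_pos (abs_pos.2 this) 2
    rw [sq_abs] at this
    linarith

lemma dotp_comm' {d : ℕ} (x y : Fin d → ℝ) : dotp x y = dotp y x := by
  unfold dotp
  exact Finset.sum_congr rfl fun i _ => mul_comm _ _

lemma dotp_comb {d : ℕ} (b x y : Fin d → ℝ) (u v : ℝ) :
    dotp b (u • x + v • y) = u * dotp b x + v * dotp b y := by
  unfold dotp
  rw [Finset.mul_sum, Finset.mul_sum, ← Finset.sum_add_distrib]
  refine Finset.sum_congr rfl fun i _ => ?_
  simp
  ring

lemma dotp_neg' {d : ℕ} (b x : Fin d → ℝ) : dotp (-b) x = - dotp b x := by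
  unfold dotp
  simp

lemma face_isExtreme_s10 {d : ℕ} (P : Set (Fin d → ℝ)) (b : Fin d → ℝ) (c : ℝ)
    (h : ∀ x ∈ P, dotp b x ≤ c) : IsExtreme ℝ P {x ∈ P | dotp b x = c} := by
  refine ⟨fun x hx => hx.1, ?_⟩
  rintro x hx y hy z ⟨_, hz⟩ ⟨u, v, hu, hv, huv, rfl⟩
  refine ⟨hx, le_antisymm (h x hx) ?_⟩
  rw [dotp_comb] at hz
  have hy' := h y hy
  by_contra hlt
  push Not at hlt
  have h1 := mul_lt_mul_of_pos_left hlt hu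
  have h2 := mul_le_mul_of_nonneg_left hy' hv.le
  have h3 : u * c + v * c = c := by rw [← add_mul, huv, one_mul]
  linarith

lemma hull_le {d n : ℕ} (q : Fin n → Fin d → ℝ) (b : Fin d → ℝ) (c : ℝ)
    (h : ∀ j, dotp b (q j) ≤ c) : ∀ x ∈ convexHull ℝ (Set.range q), dotp b x ≤ c := by
  have hc : Convex ℝ {x | dotp b x ≤ c} := by
    intro x hx y hy u v hu hv huv
    simp only [Set.mem_ofPred_eq] at *
    rw [dotp_comb]
    have h1 := mul_le_mul_of_nonneg_left hx hu
    have h2 := mul_le_mul_of_nonneg_left hy hv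
    have h3 : u * c + v * c = c := by rw [← add_mul, huv, one_mul]
    linarith
  exact convexHull_min (by rintro _ ⟨j, rfl⟩; exact h j) hc

lemma face_verts {d n : ℕ} (q : Fin n → Fin d → ℝ) (b : Fin d → ℝ) (c : ℝ)
    (S : Finset (Fin n)) (h1 : ∀ j ∈ S, dotp b (q j) = c) (h2 : ∀ j ∉ S, dotp b (q j) < c) :
    verts {x ∈ convexHull ℝ (Set.range q) | dotp b x = c} ⊆ q '' S ∧
    (S.Nonempty → (verts {x ∈ convexHull ℝ (Set.range q) | dotp b x = c}).Nonempty) := by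
  have hle : ∀ j, dotp b (q j) ≤ c := fun j => by
    by_cases hj : j ∈ S
    · exact (h1 j hj).le
    · exact (h2 j hj).le
  have hex := face_isExtreme_s10 _ b c (hull_le q b c hle)
  constructor
  · intro x hx
    obtain ⟨j, rfl⟩ := extremePoints_convexHull_subset
      (hex.extremePoints_subset_extremePoints hx)
    refine ⟨j, ?_, rfl⟩
    by_contra hj
    exact (h2 j hj).ne hx.1.2
  · rintro ⟨j, hj⟩
    refine IsCompact.extremePoints_nonempty ?_
      ⟨q j, subset_convexHull ℝ _ ⟨j, rfl⟩, h1 j hj⟩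
    have hcl : IsClosed {x : Fin d → ℝ | dotp b x = c} := by
      refine isClosed_eq ?_ continuous_const
      unfold dotp
      fun_prop
    exact (Set.Finite.isCompact_convexHull (𝕜 := ℝ) (Set.finite_range q)).inter_right hcl

/-- **Neighborliness of polytopes on a generalized moment curve.** For `d > r ≥ 0`,
arbitrary `p_1, …, p_r : ℝ → ℝ` and `n` distinct reals `t_1, …, t_n`, the polytope
`Q = conv{x(t_1), …, x(t_n)}` is `⌊(d−r)/2⌋`-neighborly: every subset `S` of the `t_i`'s
with `|S| ≤ ⌊(d−r)/2⌋` gives the vertex set `{x(t) : t ∈ S}` of a face of `Q`; in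
particular there are `b ∈ ℝ^d`, `c ∈ ℝ` with `⟨x(t), b⟩ = c` for `t ∈ S` and
`⟨x(t_l), b⟩ > c` for `t_l ∉ S`. -/
theorem gmc_neighborly (d r n : ℕ) (hr : r < d) (p : Fin r → ℝ → ℝ)
    (t : Fin n → ℝ) (ht : Function.Injective t) :
    ∀ S : Finset (Fin n), S.card ≤ (d - r) / 2 →
      (∃ G : Set (Fin d → ℝ),
        IsFaceOf (convexHull ℝ (Set.range fun j : Fin n => gmc d r p (t j))) G ∧
        verts G = (fun j : Fin n => gmc d r p (t j)) '' (S : Set (Fin n))) ∧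
      (∃ (b : Fin d → ℝ) (c : ℝ),
        (∀ j ∈ S, dotp (gmc d r p (t j)) b = c) ∧
        (∀ j : Fin n, j ∉ S → c < dotp (gmc d r p (t j)) b)) := by
  intro S hS
  obtain ⟨b, c, hb, h1, h2⟩ := gmc_sep d r n hr p t ht S hS
  refine ⟨?_, b, c, h1, h2⟩
  rcases S.eq_empty_or_nonempty with rfl | hne
  · exact ⟨∅, Or.inl rfl, by simp [verts]⟩
  set q : Fin n → Fin d → ℝ := fun j => gmc d r p (t j) with hq
  have key : ∀ (T : Finset (Fin n)) (b : Fin d → ℝ) (c : ℝ),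
      (∀ j ∈ T, dotp (q j) b = c) → (∀ j ∉ T, c < dotp (q j) b) →
      (∀ j ∈ T, dotp (-b) (q j) = -c) ∧ (∀ j ∉ T, dotp (-b) (q j) < -c) := by
    intro T b c h1 h2
    constructor
    · intro j hj
      rw [dotp_neg', dotp_comm', h1 j hj]
    · intro j hj
      rw [dotp_neg', dotp_comm']
      exact neg_lt_neg (h2 j hj)
  have hle : ∀ (T : Finset (Fin n)) (b : Fin d → ℝ) (c : ℝ),
      (∀ j ∈ T, dotp b (q j) = c) → (∀ j ∉ T, dotp b (q j) < c) →
      ∀ x ∈ convexHull ℝ (Set.range q), dotp b x ≤ c := by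
    intro T b c h1 h2
    refine hull_le q b c fun j => ?_
    by_cases hj : j ∈ T
    · exact (h1 j hj).le
    · exact (h2 j hj).le
  have hext : ∀ j, q j ∈ verts (convexHull ℝ (Set.range q)) := by
    intro j
    obtain ⟨b', c', _, h1', h2'⟩ := gmc_sep d r n hr p t ht {j}
      (by have := hne.card_pos; simp; omega)
    obtain ⟨k1, k2⟩ := key _ _ _ h1' h2'
    obtain ⟨f1, f2⟩ := face_verts q _ _ _ k1 k2
    obtain ⟨x, hx⟩ := f2 ⟨j, by simp⟩
    have hxj : x = q j := by
      obtain ⟨k, hk, rfl⟩ := f1 hx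
      simp at hk
      rw [hk]
    subst hxj
    exact (face_isExtreme_s10 _ _ _ (hle _ _ _ k1 k2)).extremePoints_subset_extremePoints hx
  obtain ⟨k1, k2⟩ := key _ _ _ h1 h2
  refine ⟨{x ∈ convexHull ℝ (Set.range q) | dotp (-b) x = -c},
    Or.inr (Or.inr ⟨-b, -c, neg_ne_zero.2 (hb hne), hle _ _ _ k1 k2, rfl⟩), ?_⟩
  refine (face_verts q _ _ _ k1 k2).1.antisymm ?_
  rintro _ ⟨j, hj, rfl⟩
  exact inter_extremePoints_subset_extremePoints_of_subset (fun x hx => hx.1)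
    ⟨⟨subset_convexHull ℝ _ ⟨j, rfl⟩, k1 j hj⟩, hext j⟩

end

end ASP
end
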